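/- arXiv:2512.09397 — 5 statements merged into one kernel-verified Lean document; each statement's English description precedes it below -/
import Mathlib

section
/- There exists a compact set K ⊆ ℝ² of Lebesgue measure zero that contains a unit line segment pointing in every direction; that is, for every unit vector e ∈ ℝ² there exists x ∈ ℝ² with the segment [x, x+e] contained in K, and yet the Lebesgue measure of K is 0. -/
open MeasureTheory

open Set Real in
/-- If the weights `c` are arbitrarily small on long blocks, in the sense that they start a block
with size at most `δ` and then grow at most linearly with rate `δ`, then the sums of binary
expansions weighted by `c` form a null set. -/
theorem volume_range_tsum_ofDigitsTerm_mul_eq_zero {c : ℕ → ℝ}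
    (hc : ∀ δ > 0, ∃ k, ∀ i : ℕ, |c (k + i)| ≤ δ * (i + 1)) :
    volume (range fun ε : ℕ → Fin 2 ↦ ∑' j, ofDigitsTerm ε j * c j) = 0 := by
  have hM : Summable fun i : ℕ ↦ ((i : ℝ) + 1) * (2 ^ (i + 1))⁻¹ := by
    have h := summable_pow_mul_geometric_of_norm_lt_one 1
      (show ‖(2⁻¹ : ℝ)‖ < 1 by norm_num)
    simpa using (summable_nat_add_iff 1).2 h
  set M := ∑' i : ℕ, ((i : ℝ) + 1) * (2 ^ (i + 1))⁻¹ with hMdef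
  have hM0 : 0 ≤ M := tsum_nonneg fun i ↦ by positivity
  have key : ∀ δ > 0, volume (range fun ε : ℕ → Fin 2 ↦ ∑' j, ofDigitsTerm ε j * c j) ≤
      ENNReal.ofReal (2 * M * δ) := by
    intro δ hδ
    obtain ⟨k, hk⟩ := hc δ hδ
    have hbound (ε : ℕ → Fin 2) (i : ℕ) : ‖ofDigitsTerm ε (i + k) * c (i + k)‖ ≤
        δ * (2 ^ k)⁻¹ * ((i + 1) * (2 ^ (i + 1))⁻¹) := by
      have h1 : ofDigitsTerm ε (i + k) ≤ (2 ^ (i + k + 1))⁻¹ := by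
        simpa using (ofDigitsTerm_le (digits := ε) (n := i + k)).trans_eq (by norm_num)
      rw [norm_mul, norm_of_nonneg ofDigitsTerm_nonneg, norm_eq_abs, add_comm i k]
      calc _ ≤ (2 ^ (i + k + 1))⁻¹ * (δ * (i + 1)) := by
            rw [add_comm i k] at h1
            rw [add_comm i k]
            exact mul_le_mul h1 (hk i) (abs_nonneg _) (by positivity)
        _ = _ := by rw [show i + k + 1 = k + (i + 1) by ring, pow_add, mul_inv]; ring
    have htail (ε : ℕ → Fin 2) : Summable fun i ↦ ofDigitsTerm ε (i + k) * c (i + k) :=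
      .of_norm_bounded (hM.mul_left _) (hbound ε)
    let r := δ * (2 ^ k)⁻¹ * M
    have hcover : (range fun ε : ℕ → Fin 2 ↦ ∑' j, ofDigitsTerm ε j * c j) ⊆
        ⋃ p : Fin k → Fin 2, Metric.closedBall
          (∑ j : Fin k, (p j : ℝ) * (2 ^ ((j : ℕ) + 1))⁻¹ * c j) r := by
      rintro _ ⟨ε, rfl⟩
      refine mem_iUnion.2 ⟨fun j ↦ ε j, ?_⟩
      have hs : Summable fun j ↦ ofDigitsTerm ε j * c j := (summable_nat_add_iff k).1 (htail ε)
      have heq : ∑ j : Fin k, ((ε j : ℕ) : ℝ) * (2 ^ ((j : ℕ) + 1))⁻¹ * c j =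
          ∑ j ∈ Finset.range k, ofDigitsTerm ε j * c j := by
        rw [Finset.sum_range]
        simp [ofDigitsTerm]
      dsimp only
      rw [Metric.mem_closedBall, heq, ← hs.sum_add_tsum_nat_add k, dist_eq_norm, add_sub_cancel_left]
      exact tsum_of_norm_bounded (hM.hasSum.mul_left _) (hbound ε)
    calc _ ≤ volume (⋃ p : Fin k → Fin 2, Metric.closedBall
          (∑ j : Fin k, (p j : ℝ) * (2 ^ ((j : ℕ) + 1))⁻¹ * c j) r) := measure_mono hcover
      _ ≤ ∑ _p : Fin k → Fin 2, ENNReal.ofReal (2 * r) := by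
        refine (measure_iUnion_fintype_le _ _).trans_eq ?_
        simp [Real.volume_closedBall]
      _ = ENNReal.ofReal (2 * M * δ) := by
        rw [← ENNReal.ofReal_sum_of_nonneg fun _ _ ↦ by positivity]
        congr 1
        simp [r]
        field_simp
  have hcont : Continuous fun δ : ℝ ↦ ENNReal.ofReal (2 * M * δ) :=
    ENNReal.continuous_ofReal.comp (continuous_const.mul continuous_id)
  have hlim : Filter.Tendsto (fun δ : ℝ ↦ ENNReal.ofReal (2 * M * δ))
      (nhdsWithin 0 (Ioi 0)) (nhds 0) := by
    simpa using (hcont.tendsto 0).mono_left nhdsWithin_le_nhds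
  exact le_antisymm (ge_of_tendsto hlim (eventually_nhdsWithin_of_forall key)) zero_le

/-- The sequence `sin √j` comes arbitrarily close to every point of `[-1, 1]`, and moves away from
it arbitrarily slowly. -/
theorem exists_forall_abs_sub_sin_sqrt_le {t : ℝ} (ht : t ∈ Set.Icc (-1) 1) {δ : ℝ} (hδ : 0 < δ) :
    ∃ k : ℕ, ∀ i : ℕ, |t - Real.sin √(k + i : ℕ)| ≤ δ * (i + 1) := by
  obtain ⟨m, hm⟩ := exists_nat_gt (δ⁻¹ + 2)
  set x := Real.arcsin t + m * (2 * Real.pi) with hx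
  have hxt : Real.sin x = t := by
    rw [hx, Real.sin_add_nat_mul_two_pi, Real.sin_arcsin ht.1 ht.2]
  have hδ' : 0 < δ⁻¹ := inv_pos.2 hδ
  have hxδ : δ⁻¹ ≤ x := by
    have := Real.neg_pi_div_two_le_arcsin t
    have := Real.pi_gt_three
    have := Real.pi_lt_four
    nlinarith
  have hx0 : 0 < x := hδ'.trans_le hxδ
  refine ⟨⌈x ^ 2⌉₊, fun i ↦ ?_⟩
  have h1 : x ^ 2 ≤ (⌈x ^ 2⌉₊ : ℝ) := Nat.le_ceil _
  have h2 : (⌈x ^ 2⌉₊ : ℝ) < x ^ 2 + 1 := Nat.ceil_lt_add_one (by positivity)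
  have hi : (0 : ℝ) ≤ i := by positivity
  set s := √(⌈x ^ 2⌉₊ + i : ℕ) with hs
  have hsq : s ^ 2 = ⌈x ^ 2⌉₊ + i := by rw [hs, Real.sq_sqrt (by positivity)]; push_cast; rfl
  have hxs : x ≤ s := by
    apply Real.le_sqrt_of_sq_le
    push_cast
    linarith
  rw [← hxt, abs_sub_comm]
  refine (Real.abs_sin_sub_sin_le s x).trans ?_
  rw [abs_of_nonneg (by linarith)]
  have h3 : δ⁻¹ * (s - x) ≤ i + 1 := by nlinarith
  rwa [inv_mul_le_iff₀ hδ] at h3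

/-- The ordinate at abscissa `t` of the line with slope `2 * Real.ofDigits ε - 1` in the
Besicovitch set. -/
noncomputable def besicovitchLine (t : ℝ) (ε : ℕ → Fin 2) : ℝ :=
  (∑' j, Real.ofDigitsTerm ε j * (2 * (t - Real.sin √j))) - t

theorem summable_ofDigitsTerm_mul_sin_sqrt (ε : ℕ → Fin 2) :
    Summable fun j : ℕ ↦ Real.ofDigitsTerm ε j * Real.sin √j := by
  refine .of_norm_bounded (Real.summable_ofDigitsTerm (digits := ε)) fun j ↦ ?_
  rw [norm_mul, Real.norm_of_nonneg Real.ofDigitsTerm_nonneg]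
  exact mul_le_of_le_one_right Real.ofDigitsTerm_nonneg (Real.abs_sin_le_one _)

theorem besicovitchLine_eq (t : ℝ) (ε : ℕ → Fin 2) :
    besicovitchLine t ε = t * (2 * Real.ofDigits ε - 1) -
      2 * ∑' j : ℕ, Real.ofDigitsTerm ε j * Real.sin √j := by
  have h : ∑' j : ℕ, Real.ofDigitsTerm ε j * (2 * (t - Real.sin √j)) =
      2 * t * Real.ofDigits ε - 2 * ∑' j : ℕ, Real.ofDigitsTerm ε j * Real.sin √j := by
    rw [Real.ofDigits, ← tsum_mul_left, ← tsum_mul_left,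
      ← (Real.summable_ofDigitsTerm.mul_left _).tsum_sub
        ((summable_ofDigitsTerm_mul_sin_sqrt ε).mul_left _)]
    exact tsum_congr fun j ↦ by ring
  rw [besicovitchLine, h]
  ring

theorem continuous_besicovitchLine :
    Continuous fun p : ℝ × (ℕ → Fin 2) ↦ besicovitchLine p.1 p.2 := by
  have h : Continuous fun ε : ℕ → Fin 2 ↦ ∑' j : ℕ, Real.ofDigitsTerm ε j * Real.sin √j := by
    refine continuous_tsum (u := fun j ↦ (1 / 2 : ℝ) ^ (j + 1)) (fun j ↦ ?_)
      ((summable_nat_add_iff 1).2 summable_geometric_two) fun j ε ↦ ?_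
    · unfold Real.ofDigitsTerm
      fun_prop
    · rw [norm_mul, Real.norm_of_nonneg Real.ofDigitsTerm_nonneg]
      refine (mul_le_of_le_one_right Real.ofDigitsTerm_nonneg (Real.abs_sin_le_one _)).trans ?_
      exact Real.ofDigitsTerm_le.trans_eq (by rw [one_div, inv_pow]; norm_num)
  have h' : Continuous (@Real.ofDigits 2) := Real.continuous_ofDigits
  simp only [besicovitchLine_eq]
  exact (continuous_fst.mul ((continuous_const.mul (h'.comp continuous_snd)).sub
    continuous_const)).sub (continuous_const.mul (h.comp continuous_snd))

theorem volume_range_besicovitchLine {t : ℝ} (ht : t ∈ Set.Icc (-1) 1) :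
    volume (Set.range (besicovitchLine t)) = 0 := by
  have h : volume (Set.range fun ε : ℕ → Fin 2 ↦
      ∑' j : ℕ, Real.ofDigitsTerm ε j * (2 * (t - Real.sin √j))) = 0 := by
    refine volume_range_tsum_ofDigitsTerm_mul_eq_zero fun δ hδ ↦ ?_
    obtain ⟨k, hk⟩ := exists_forall_abs_sub_sin_sqrt_le ht (half_pos hδ)
    refine ⟨k, fun i ↦ ?_⟩
    rw [abs_mul, abs_two]
    linarith [hk i]
  rw [← measure_preimage_add_right volume t] at h
  refine measure_mono_null ?_ h
  rintro _ ⟨ε, rfl⟩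
  exact ⟨ε, by simp [besicovitchLine]⟩

/-- A compact null set containing a segment over `[0, 1]` of every slope in `[-1, 1]`. -/
def besicovitchGraph : Set (ℝ × ℝ) :=
  (fun p : ℝ × (ℕ → Fin 2) ↦ (p.1, besicovitchLine p.1 p.2)) '' (Set.Icc 0 1 ×ˢ Set.univ)

theorem isCompact_besicovitchGraph : IsCompact besicovitchGraph :=
  (isCompact_Icc.prod isCompact_univ).image
    (continuous_fst.prodMk continuous_besicovitchLine)

theorem volume_besicovitchGraph : volume besicovitchGraph = 0 := by
  rw [Measure.volume_eq_prod, Measure.measure_prod_null isCompact_besicovitchGraph.measurableSet]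
  refine .of_forall fun t ↦ ?_
  by_cases ht : t ∈ Set.Icc (-1 : ℝ) 1
  · refine measure_mono_null ?_ (volume_range_besicovitchLine ht)
    rintro y ⟨⟨s, ε⟩, -, h⟩
    obtain ⟨rfl, rfl⟩ := Prod.mk.inj h
    exact ⟨ε, rfl⟩
  · refine measure_mono_null (Eq.subset ?_) measure_empty
    refine Set.eq_empty_of_forall_notMem ?_
    rintro y ⟨⟨s, ε⟩, ⟨hs, -⟩, h⟩
    obtain ⟨rfl, rfl⟩ := Prod.mk.inj h
    exact ht ⟨by linarith [hs.1], hs.2⟩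

theorem exists_forall_mem_besicovitchGraph {u v : ℝ} (hu : |u| ≤ 1) (huv : |v| ≤ |u|) :
    ∃ a b : ℝ, ∀ θ ∈ Set.Icc (0 : ℝ) 1, (a + θ * u, b + θ * v) ∈ besicovitchGraph := by
  have hq : |v / u| ≤ 1 := by
    rw [abs_div]
    exact div_le_one_of_le₀ huv (abs_nonneg _)
  obtain ⟨hq1, hq2⟩ := abs_le.1 hq
  obtain ⟨ε, -, hε⟩ := Real.ofDigits_SurjOn (b := 2) one_lt_two
    (show (v / u + 1) / 2 ∈ Set.Icc (0 : ℝ) 1 from ⟨by linarith, by linarith⟩)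
  have hv : u * (v / u) = v := by
    refine mul_div_cancel_of_imp' fun h ↦ ?_
    simpa [h] using huv
  obtain ⟨hu1, hu2⟩ := abs_le.1 hu
  refine ⟨(1 - u) / 2, besicovitchLine ((1 - u) / 2) ε, fun θ ⟨hθ0, hθ1⟩ ↦
    ⟨((1 - u) / 2 + θ * u, ε), ⟨⟨?_, ?_⟩, trivial⟩, Prod.ext rfl ?_⟩⟩
  · dsimp only
    nlinarith
  · dsimp only
    nlinarith
  · simp only [besicovitchLine_eq, hε]
    linear_combination θ * hv

/-- There exists a compact set `K ⊆ ℝ²` of Lebesgue measure zero that contains a unit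
line segment pointing in every direction. -/
theorem besicovitch_set_exists :
    ∃ K : Set (EuclideanSpace ℝ (Fin 2)), IsCompact K ∧ volume K = 0 ∧
      ∀ e : EuclideanSpace ℝ (Fin 2), ‖e‖ = 1 →
        ∃ x : EuclideanSpace ℝ (Fin 2), segment ℝ x (x + e) ⊆ K := by
  let L : Set (ℝ × ℝ) := besicovitchGraph ∪ Prod.swap '' besicovitchGraph
  have hL : IsCompact L :=
    isCompact_besicovitchGraph.union (isCompact_besicovitchGraph.image continuous_swap)
  have hL0 : volume L = 0 := by
    refine measure_union_null volume_besicovitchGraph ?_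
    rw [Set.image_swap_eq_preimage_swap]
    exact (Measure.measurePreserving_swap (μ := (volume : Measure ℝ))
      (ν := (volume : Measure ℝ))).measure_preimage
      isCompact_besicovitchGraph.measurableSet.nullMeasurableSet |>.trans volume_besicovitchGraph
  have hmem (x : EuclideanSpace ℝ (Fin 2)) (h : (x 0, x 1) ∈ L) :
      x ∈ (fun p : ℝ × ℝ ↦ !₂[p.1, p.2]) '' L :=
    ⟨_, h, by ext i; fin_cases i <;> rfl⟩
  refine ⟨(fun p : ℝ × ℝ ↦ !₂[p.1, p.2]) '' L, hL.image (by fun_prop), ?_, fun e he ↦ ?_⟩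
  · have hφ := (volume_preserving_finTwoArrow ℝ).comp (PiLp.volume_preserving_ofLp (Fin 2))
    have h := hφ.measure_preimage hL.measurableSet.nullMeasurableSet
    rw [hL0] at h
    refine measure_mono_null ?_ h
    rintro _ ⟨p, hp, rfl⟩
    exact hp
  · have hle (i : Fin 2) : |e i| ≤ 1 := he ▸ PiLp.norm_apply_le e i
    rcases le_total |e 1| |e 0| with h | h
    · obtain ⟨a, b, hab⟩ := exists_forall_mem_besicovitchGraph (hle 0) h
      refine ⟨!₂[a, b], ?_⟩
      rw [segment_eq_image']
      rintro _ ⟨θ, hθ, rfl⟩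
      exact hmem _ (.inl (by simpa using hab θ hθ))
    · obtain ⟨a, b, hab⟩ := exists_forall_mem_besicovitchGraph (hle 1) h
      refine ⟨!₂[b, a], ?_⟩
      rw [segment_eq_image']
      rintro _ ⟨θ, hθ, rfl⟩
      exact hmem _ (.inr ⟨_, by simpa using hab θ hθ, by simp⟩)
end

section
/- For every η > 0 there exist δ ∈ (0,1) and a finite family 𝕋 of δ-tubes in ℝ² pointing in δ-separated directions such that Σ_{T∈𝕋} |T| ≥ 1 while |⋃_{T∈𝕋} T| < η. (The Besicovitch compression phenomenon.) -/
open MeasureTheory Metric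

/-- A `δ`-tube in `ℝⁿ`: the closed `δ`-neighborhood of the unit line segment from
`x` to `x + e` (where `‖e‖ = 1`). -/
noncomputable def tube {n : ℕ} (δ : ℝ) (x e : EuclideanSpace ℝ (Fin n)) :
    Set (EuclideanSpace ℝ (Fin n)) :=
  cthickening δ (segment ℝ x (x + e))

theorem volume_eq_lintegral_slice {A : Set (EuclideanSpace ℝ (Fin 2))} (hA : MeasurableSet A) :
    volume A = ∫⁻ p : ℝ, volume {q : ℝ | !₂[p, q] ∈ A} := by
  have h1 := (EuclideanSpace.volume_preserving_symm_measurableEquiv_toLp (Fin 2)).symm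
  have h2 := (volume_preserving_finTwoArrow ℝ).symm
  have h := h1.comp h2
  rw [← h.measure_preimage hA.nullMeasurableSet, Measure.volume_eq_prod,
    Measure.prod_apply (h.measurable hA)]
  refine lintegral_congr fun p => congrArg _ ?_
  ext q
  simp

theorem isCompact_segment {E : Type*} [NormedAddCommGroup E] [NormedSpace ℝ E] (x y : E) :
    IsCompact (segment ℝ x y) := by
  rw [segment_eq_image]
  exact isCompact_Icc.image (by fun_prop)

theorem measurableSet_tube {n : ℕ} (δ : ℝ) (x e : EuclideanSpace ℝ (Fin n)) :
    MeasurableSet (tube δ x e) :=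
  isClosed_cthickening.measurableSet

/-- A tube around a nearly horizontal segment lies in a thin vertical neighbourhood of the line
`q = a p + b`. -/
theorem tube_subset_strip {δ a b c p q : ℝ} (hδ : 0 ≤ δ) (hc0 : 0 ≤ c) (hc1 : c ≤ 1)
    (ha : |a| ≤ 1) (h : !₂[p, q] ∈ tube δ !₂[0, b] (c • !₂[1, a])) :
    -δ ≤ p ∧ p ≤ 1 + δ ∧ |q - (p * a + b)| ≤ 2 * δ := by
  rw [tube, (isCompact_segment _ _).cthickening_eq_biUnion_closedBall hδ] at h
  simp only [Set.mem_iUnion, segment_eq_image', exists_prop, Set.mem_image] at h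
  obtain ⟨_, ⟨θ, ⟨h0, h1⟩, rfl⟩, hz⟩ := h
  rw [mem_closedBall, dist_eq_norm] at hz
  have e0 := (PiLp.norm_apply_le _ (0 : Fin 2)).trans hz
  have e1 := (PiLp.norm_apply_le _ (1 : Fin 2)).trans hz
  simp [abs_le] at e0 e1
  have ht0 : 0 ≤ θ * c := by positivity
  have ht1 : θ * c ≤ 1 := mul_le_one₀ h1 hc0 hc1
  refine ⟨by linarith, by linarith, ?_⟩
  have key : |(p - θ * c) * a| ≤ δ * 1 := by
    rw [abs_mul]
    exact mul_le_mul (abs_le.2 ⟨by linarith, by linarith⟩) ha (abs_nonneg _) hδ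
  rw [abs_le] at key ⊢
  constructor <;> nlinarith

/-- The tube contains a vertical neighbourhood of its core segment. -/
theorem strip_subset_tube {δ a b c p q : ℝ} (hc : 0 < c) (hp0 : 0 ≤ p) (hpc : p ≤ c)
    (h : |q - (p * a + b)| ≤ δ) : !₂[p, q] ∈ tube δ !₂[0, b] (c • !₂[1, a]) := by
  refine mem_cthickening_of_dist_le _ (!₂[0, b] + (p / c) • (c • !₂[1, a])) _ _ ?_ ?_
  · rw [segment_eq_image']
    exact ⟨p / c, ⟨by positivity, (div_le_one hc).2 hpc⟩, by simp⟩
  · rw [smul_smul, div_mul_cancel₀ _ hc.ne', EuclideanSpace.dist_eq]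
    simp only [Fin.sum_univ_two]
    simp [Real.dist_eq, Real.sqrt_sq_eq_abs]
    rwa [add_comm b]

theorem le_volume_tube {δ a b c r : ℝ} (hr : 0 < r) (hc : r ≤ c) :
    r * (2 * δ) ≤ (volume (tube δ !₂[0, b] (c • !₂[1, a]))).toReal := by
  have hfin : volume (tube δ !₂[0, b] (c • !₂[1, a])) ≠ ⊤ :=
    (isCompact_segment _ _).cthickening.measure_lt_top.ne
  rw [← ENNReal.ofReal_le_iff_le_toReal hfin, volume_eq_lintegral_slice (measurableSet_tube _ _ _)]
  calc ENNReal.ofReal (r * (2 * δ)) = ∫⁻ _ in Set.Icc 0 r, ENNReal.ofReal (2 * δ) := by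
        rw [setLIntegral_const, Real.volume_Icc, mul_comm, ENNReal.ofReal_mul' (by positivity),
          sub_zero]
    _ ≤ ∫⁻ p in Set.Icc 0 r, volume {q : ℝ | !₂[p, q] ∈ tube δ !₂[0, b] (c • !₂[1, a])} := by
        refine setLIntegral_mono' measurableSet_Icc fun p hp => ?_
        rw [← Real.volume_closedBall (p * a + b)]
        refine measure_mono fun q hq => ?_
        exact strip_subset_tube (hr.trans_le hc) hp.1 (hp.2.trans hc) hq
    _ ≤ _ := setLIntegral_le_lintegral _ _

/-- Unit directions of slopes `a`, `a'` are at least `c c' |a - a'|` apart, up to sign. -/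
theorem mul_abs_sub_le_norm_sub {a a' c c' : ℝ} (hc : 0 ≤ c) (hc' : 0 ≤ c')
    (h' : ‖c' • !₂[1, a']‖ = 1) (σ : ℝ) :
    c * c' * |a - a'| ≤ ‖c • !₂[1, a] - σ • c' • !₂[1, a']‖ := by
  have h2 : c' ^ 2 + (c' * a') ^ 2 = 1 := by
    have := EuclideanSpace.norm_sq_eq (c' • !₂[1, a'])
    rw [h'] at this
    simpa [Fin.sum_univ_two, mul_pow] using this.symm
  rw [← abs_of_nonneg (mul_nonneg hc hc'), ← abs_mul, EuclideanSpace.norm_eq]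
  refine Real.abs_le_sqrt ?_
  simp only [Fin.sum_univ_two]
  simp
  have := sq_nonneg ((c - σ * c') * c' + (c * a - σ * (c' * a')) * (c' * a'))
  calc _ = ((c - σ * c') * (c' * a') - (c * a - σ * (c' * a')) * c') ^ 2 := by ring
    _ ≤ ((c - σ * c') ^ 2 + (c * a - σ * (c' * a')) ^ 2) * (c' ^ 2 + (c' * a') ^ 2) := by
        nlinarith
    _ = _ := by rw [h2, mul_one]

/-- The intercepts of the compressed family: a discretized Sawyer function. -/
noncomputable def sawyer (M L j : ℕ) : ℝ :=
  -(∑ m ∈ Finset.range M, ((j % 2 ^ (L - (m + 1)) : ℕ) : ℝ)) / (M * 2 ^ L)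

theorem abs_sum_mod_sub_le {L k n i j : ℕ} (hkn : k ≤ n) (hnL : n ≤ L)
    (hij : i / 2 ^ (L - k) = j / 2 ^ (L - k)) :
    |∑ m ∈ Finset.range n, (((i % 2 ^ (L - (m + 1)) : ℕ) : ℝ) - (j % 2 ^ (L - (m + 1)) : ℕ))
      - k * ((i : ℝ) - j)| ≤ 2 ^ L * ((1 / 2) ^ k - (1 / 2) ^ n) := by
  induction n, hkn using Nat.le_induction with
  | base =>
    have : ∀ m ∈ Finset.range k,
        ((i % 2 ^ (L - (m + 1)) : ℕ) : ℝ) - (j % 2 ^ (L - (m + 1)) : ℕ) = (i : ℝ) - j := by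
      intro m hm
      have hm := Finset.mem_range.1 hm
      have hq : i / 2 ^ (L - (m + 1)) = j / 2 ^ (L - (m + 1)) := by
        have : L - (m + 1) = (L - k) + (k - (m + 1)) := by omega
        rw [this, pow_add, ← Nat.div_div_eq_div_mul, ← Nat.div_div_eq_div_mul, hij]
      have h1 := Nat.mod_add_div i (2 ^ (L - (m + 1)))
      have h2 := Nat.mod_add_div j (2 ^ (L - (m + 1)))
      rw [hq] at h1
      have h1' := congrArg (Nat.cast (R := ℝ)) h1
      have h2' := congrArg (Nat.cast (R := ℝ)) h2
      rw [Nat.cast_add] at h1' h2'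
      linarith
    rw [Finset.sum_congr rfl this]
    simp [mul_sub]
  | succ n hkn ih =>
    have ih := ih (by omega)
    rw [Finset.sum_range_succ]
    have hd : |((i % 2 ^ (L - (n + 1)) : ℕ) : ℝ) - (j % 2 ^ (L - (n + 1)) : ℕ)|
        ≤ 2 ^ L * (1 / 2) ^ (n + 1) := by
      have hpow : (2 : ℝ) ^ L * (1 / 2) ^ (n + 1) = 2 ^ (L - (n + 1)) := by
        rw [one_div, inv_pow, ← div_eq_mul_inv, pow_sub₀ _ two_ne_zero hnL, div_eq_mul_inv]
      rw [hpow]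
      have hi := Nat.mod_lt i (Nat.two_pow_pos (L - (n + 1)))
      have hj := Nat.mod_lt j (Nat.two_pow_pos (L - (n + 1)))
      have hi' : ((i % 2 ^ (L - (n + 1)) : ℕ) : ℝ) ≤ 2 ^ (L - (n + 1)) := by exact_mod_cast hi.le
      have hj' : ((j % 2 ^ (L - (n + 1)) : ℕ) : ℝ) ≤ 2 ^ (L - (n + 1)) := by exact_mod_cast hj.le
      rw [abs_le]
      constructor <;> linarith [Nat.cast_nonneg (α := ℝ) (i % 2 ^ (L - (n + 1))),
        Nat.cast_nonneg (α := ℝ) (j % 2 ^ (L - (n + 1)))]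
    have hs : ((1 : ℝ) / 2) ^ n = 2 * (1 / 2) ^ (n + 1) := by ring
    rw [hs] at ih
    rw [abs_le] at *
    constructor <;> linarith

/-- At abscissa `p ≈ k / M`, the lines whose indices share the first `k` binary digits are
bunched together. -/
theorem abs_line_sub_line_le {M L k i j : ℕ} (hM : 0 < M) (hkM : k ≤ M) (hML : M ≤ L)
    (hij : i / 2 ^ (L - k) = j / 2 ^ (L - k)) (p : ℝ) :
    |(p * ((i : ℝ) / 2 ^ L - 1 / 2) + sawyer M L i) - (p * ((j : ℝ) / 2 ^ L - 1 / 2) + sawyer M L j)|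
      ≤ (|p - k / M| + 1 / M) * (1 / 2) ^ k := by
  have hS := abs_sum_mod_sub_le hkM hML hij
  rw [Finset.sum_sub_distrib] at hS
  have hM' : (0 : ℝ) < M := by exact_mod_cast hM
  have hd : |(i : ℝ) - j| ≤ 2 ^ L * (1 / 2) ^ k := by
    have hpow : (2 : ℝ) ^ L * (1 / 2) ^ k = 2 ^ (L - k) := by
      rw [one_div, inv_pow, ← div_eq_mul_inv, pow_sub₀ _ two_ne_zero (hkM.trans hML),
        div_eq_mul_inv]
    rw [hpow]
    have hi := Nat.mod_lt i (Nat.two_pow_pos (L - k))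
    have hj := Nat.mod_lt j (Nat.two_pow_pos (L - k))
    have h1 := Nat.mod_add_div i (2 ^ (L - k))
    have h2 := Nat.mod_add_div j (2 ^ (L - k))
    rw [hij] at h1
    have h3 : (i : ℝ) ≤ j + 2 ^ (L - k) := by
      have : i ≤ j + 2 ^ (L - k) := by omega
      exact_mod_cast this
    have h4 : (j : ℝ) ≤ i + 2 ^ (L - k) := by
      have : j ≤ i + 2 ^ (L - k) := by omega
      exact_mod_cast this
    rw [abs_le]
    constructor <;> linarith
  simp only [sawyer]
  set A := ∑ m ∈ Finset.range M, ((i % 2 ^ (L - (m + 1)) : ℕ) : ℝ)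
  set B := ∑ m ∈ Finset.range M, ((j % 2 ^ (L - (m + 1)) : ℕ) : ℝ)
  have hP : (0 : ℝ) < 2 ^ L := by positivity
  set P : ℝ := 2 ^ L
  have hS' : |A - B - k * ((i : ℝ) - j)| ≤ P * (1 / 2) ^ k := by
    refine hS.trans ?_
    gcongr
    linarith [show (0 : ℝ) ≤ (1 / 2) ^ M by positivity]
  calc _ = |(p - k / M) * (((i : ℝ) - j) / P) - 1 / M * ((A - B - k * ((i : ℝ) - j)) / P)| := by
        congr 1
        field_simp
        ring
    _ ≤ |p - k / M| * (|(i : ℝ) - j| / P) + 1 / M * (|A - B - k * ((i : ℝ) - j)| / P) := by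
        refine (abs_sub _ _).trans ?_
        rw [abs_mul, abs_mul, abs_div _ P, abs_div _ P, abs_of_pos hP,
          abs_of_pos (a := 1 / (M : ℝ)) (by positivity)]
    _ ≤ |p - k / M| * (1 / 2) ^ k + 1 / M * (1 / 2) ^ k := by
        gcongr
        · rwa [div_le_iff₀ hP, mul_comm _ P]
        · rwa [div_le_iff₀ hP, mul_comm _ P]
    _ = _ := by ring

theorem volume_slice_le {M L k : ℕ} (hM : 0 < M) (hkM : k ≤ M) (hML : M ≤ L) {p ε : ℝ}
    (hp : |p - k / M| ≤ 2 / M) :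
    volume (⋃ i : Fin (2 ^ L),
      closedBall (p * (((i : ℕ) : ℝ) / 2 ^ L - 1 / 2) + sawyer M L i) ε)
      ≤ ENNReal.ofReal (6 / M + 2 * 2 ^ k * ε) := by
  set g : ℕ → ℝ := fun i => p * ((i : ℝ) / 2 ^ L - 1 / 2) + sawyer M L i
  set R : ℝ := 3 / M * (1 / 2) ^ k + ε
  have hsub : (⋃ i : Fin (2 ^ L), closedBall (g i) ε) ⊆
      ⋃ B ∈ Finset.range (2 ^ k), closedBall (g (B * 2 ^ (L - k))) R := by
    refine Set.iUnion_subset fun i => ?_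
    have hB : (i : ℕ) / 2 ^ (L - k) < 2 ^ k := by
      rw [Nat.div_lt_iff_lt_mul (by positivity), ← pow_add, Nat.add_sub_cancel' (hkM.trans hML)]
      exact i.2
    refine Set.Subset.trans ?_ (Set.subset_biUnion_of_mem (Finset.mem_range.2 hB))
    refine closedBall_subset_closedBall' ?_
    have := abs_line_sub_line_le (i := i) (j := (i : ℕ) / 2 ^ (L - k) * 2 ^ (L - k)) hM hkM hML
      (by rw [Nat.mul_div_cancel _ (by positivity)]) p
    have h3 : (|p - k / M| + 1 / M) * (1 / 2) ^ k ≤ 3 / M * (1 / 2 : ℝ) ^ k := by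
      gcongr
      calc _ ≤ 2 / (M : ℝ) + 1 / M := by gcongr
        _ = _ := by ring
    rw [Real.dist_eq]
    simp only [R]
    linarith
  calc _ ≤ _ := measure_mono hsub
    _ ≤ ∑ B ∈ Finset.range (2 ^ k), volume (closedBall (g (B * 2 ^ (L - k))) R) :=
        measure_biUnion_finset_le _ _
    _ = ENNReal.ofReal (2 ^ k * (2 * R)) := by
        simp only [Real.volume_closedBall, Finset.sum_const, Finset.card_range, nsmul_eq_mul]
        rw [ENNReal.ofReal_mul (p := 2 ^ k) (by positivity), ENNReal.ofReal_pow (by positivity)]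
        simp
    _ = _ := by
        congr 1
        simp only [R, one_div, inv_pow]
        field_simp
        ring

theorem exists_nat_abs_sub_div_le {M : ℕ} (hM : 0 < M) {p : ℝ} (h0 : -(1 / M) ≤ p)
    (h1 : p ≤ 1 + 1 / M) : ∃ k ≤ M, |p - k / M| ≤ 2 / (M : ℝ) := by
  have hM' : (0 : ℝ) < M := by exact_mod_cast hM
  have hM1 : (1 / (M : ℝ)) * M = 1 := by field_simp
  refine ⟨min ⌊p * M⌋₊ M, min_le_right _ _, ?_⟩
  have key : |p * M - (min ⌊p * M⌋₊ M : ℕ)| ≤ 2 := by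
    have hlo : -1 ≤ p * M := by nlinarith
    have hhi : p * M ≤ M + 1 := by nlinarith
    have hlt := Nat.lt_floor_add_one (p * M)
    rcases le_total ⌊p * M⌋₊ M with h | h
    · rw [min_eq_left h]
      rcases le_total 0 (p * M) with hp | hp
      · have := Nat.floor_le hp
        rw [abs_le]; constructor <;> linarith
      · rw [Nat.floor_of_nonpos hp] at *
        rw [abs_le]; push_cast at *; constructor <;> linarith
    · rw [min_eq_right h]
      have : (M : ℝ) ≤ p * M := (Nat.le_floor_iff' hM.ne').1 h
      rw [abs_le]; constructor <;> linarith
  have : p - (min ⌊p * M⌋₊ M : ℕ) / (M : ℝ) = (p * M - (min ⌊p * M⌋₊ M : ℕ)) / M := by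
    field_simp
  rw [this, abs_div, abs_of_pos hM']
  gcongr

theorem volume_iUnion_tube_le {M : ℕ} (hM : 0 < M) {δ : ℝ} (hδ0 : 0 ≤ δ)
    (hδ : δ ≤ (1 / 2) ^ (2 * M)) {c : Fin (2 ^ (2 * M)) → ℝ} (hc0 : ∀ i, 0 ≤ c i)
    (hc1 : ∀ i, c i ≤ 1) :
    (volume (⋃ i : Fin (2 ^ (2 * M)), tube δ !₂[0, sawyer M (2 * M) i]
      (c i • !₂[1, ((i : ℕ) : ℝ) / 2 ^ (2 * M) - 1 / 2]))).toReal ≤ 30 / M := by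
  have hM' : (1 : ℝ) ≤ M := by exact_mod_cast hM
  have hpow : ((1 : ℝ) / 2) ^ M ≤ 1 / M := by
    rw [one_div, inv_pow, ← one_div]
    gcongr
    exact_mod_cast (Nat.lt_two_pow_self (n := M)).le
  have hpowδ : 2 ^ M * δ ≤ 1 / M := by
    refine le_trans ?_ hpow
    calc 2 ^ M * δ ≤ 2 ^ M * (1 / 2) ^ (2 * M) := by gcongr
      _ = (1 / 2) ^ M := by
        rw [two_mul, pow_add, ← mul_assoc, ← mul_pow]; norm_num
  have hδM : δ ≤ 1 / M := by
    refine le_trans ?_ hpowδ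
    exact le_mul_of_one_le_left hδ0 (one_le_pow₀ one_le_two)
  have hM1 : 1 / (M : ℝ) ≤ 1 := by rw [div_le_one (by positivity)]; exact hM'
  refine ENNReal.toReal_le_of_le_ofReal (by positivity) ?_
  rw [volume_eq_lintegral_slice (MeasurableSet.iUnion fun i => measurableSet_tube _ _ _)]
  calc _ ≤ ∫⁻ p, (Set.Icc (-1 : ℝ) 2).indicator (fun _ => ENNReal.ofReal (10 / M)) p := by
        refine lintegral_mono fun p => ?_
        have hslope : ∀ i : Fin (2 ^ (2 * M)), |((i : ℕ) : ℝ) / 2 ^ (2 * M) - 1 / 2| ≤ 1 := by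
          intro i
          have : ((i : ℕ) : ℝ) / 2 ^ (2 * M) ≤ 1 := by
            rw [div_le_one (by positivity)]
            exact_mod_cast i.2.le
          have h0 : 0 ≤ ((i : ℕ) : ℝ) / 2 ^ (2 * M) := by positivity
          rw [abs_le]; constructor <;> linarith
        by_cases hp : -δ ≤ p ∧ p ≤ 1 + δ
        · rw [Set.indicator_of_mem (show p ∈ Set.Icc (-1 : ℝ) 2 from ⟨by linarith, by linarith⟩)]
          obtain ⟨k, hkM, hk⟩ := exists_nat_abs_sub_div_le hM (p := p) (by linarith) (by linarith)
          calc _ ≤ _ := measure_mono (t := ⋃ i : Fin (2 ^ (2 * M)),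
                closedBall (p * (((i : ℕ) : ℝ) / 2 ^ (2 * M) - 1 / 2) + sawyer M (2 * M) i)
                  (2 * δ)) ?_
            _ ≤ _ := volume_slice_le hM hkM (by omega) hk
            _ ≤ _ := by
              refine ENNReal.ofReal_le_ofReal ?_
              have : (2 : ℝ) ^ k * δ ≤ 2 ^ M * δ := by
                gcongr
                exact one_le_two
              calc 6 / (M : ℝ) + 2 * 2 ^ k * (2 * δ) = 6 / M + 4 * (2 ^ k * δ) := by ring
                _ ≤ 6 / M + 4 * (1 / M) := by linarith
                _ = _ := by ring
          intro q hq
          obtain ⟨i, hi⟩ := Set.mem_iUnion.1 hq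
          exact Set.mem_iUnion.2
            ⟨i, (tube_subset_strip hδ0 (hc0 i) (hc1 i) (hslope i) hi).2.2⟩
        · have : {q : ℝ | !₂[p, q] ∈ ⋃ i : Fin (2 ^ (2 * M)), tube δ !₂[0, sawyer M (2 * M) i]
              (c i • !₂[1, ((i : ℕ) : ℝ) / 2 ^ (2 * M) - 1 / 2])} = ∅ := by
            refine Set.eq_empty_of_forall_notMem fun q hq => hp ?_
            obtain ⟨i, hi⟩ := Set.mem_iUnion.1 hq
            have := tube_subset_strip hδ0 (hc0 i) (hc1 i) (hslope i) hi
            exact ⟨this.1, this.2.1⟩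
          rw [this, measure_empty]
          exact zero_le
    _ = ENNReal.ofReal (30 / M) := by
        rw [lintegral_indicator_const measurableSet_Icc, Real.volume_Icc,
          ← ENNReal.ofReal_mul (by positivity)]
        congr 1
        ring

/-- The Besicovitch compression phenomenon: for every `η > 0` there exist `δ ∈ (0,1)`
and a finite family of `δ`-tubes in `ℝ²` pointing in `δ`-separated directions whose
total measure is at least `1`, but whose union has measure less than `η`. -/
theorem besicovitch_compression (η : ℝ) (hη : 0 < η) :
    ∃ δ : ℝ, 0 < δ ∧ δ < 1 ∧
      ∃ (N : ℕ) (x e : Fin N → EuclideanSpace ℝ (Fin 2)),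
        (∀ i, ‖e i‖ = 1) ∧
        (∀ i j, i ≠ j → δ ≤ min ‖e i - e j‖ ‖e i + e j‖) ∧
        1 ≤ ∑ i, (volume (tube δ (x i) (e i))).toReal ∧
        (volume (⋃ i, tube δ (x i) (e i))).toReal < η := by
  obtain ⟨M, hMη⟩ := exists_nat_gt (30 / η)
  have hM' : (0 : ℝ) < M := lt_trans (by positivity) hMη
  have hM : 0 < M := by exact_mod_cast hM'
  set P : ℝ := 2 ^ (2 * M) with hP
  have hP1 : 1 ≤ P := one_le_pow₀ one_le_two
  have hP0 : 0 < P := by linarith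
  let a : Fin (2 ^ (2 * M)) → ℝ := fun i => ((i : ℕ) : ℝ) / P - 1 / 2
  have ha : ∀ i, a i ^ 2 ≤ 1 / 4 := by
    intro i
    have h1 : ((i : ℕ) : ℝ) / P ≤ 1 := by
      rw [div_le_one hP0, hP]
      exact_mod_cast i.2.le
    have h0 : 0 ≤ ((i : ℕ) : ℝ) / P := by positivity
    simp only [a]
    nlinarith
  let c : Fin (2 ^ (2 * M)) → ℝ := fun i => (√(1 + a i ^ 2))⁻¹
  have hc0 : ∀ i, 0 < c i := fun i => inv_pos.2 (Real.sqrt_pos.2 (by positivity))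
  have hc2 : ∀ i, c i ^ 2 * (1 + a i ^ 2) = 1 := by
    intro i
    have : 0 < 1 + a i ^ 2 := by positivity
    simp only [c]
    rw [inv_pow, Real.sq_sqrt this.le, inv_mul_cancel₀ this.ne']
  have hc1 : ∀ i, c i ≤ 1 := fun i => by nlinarith [hc2 i, hc0 i, sq_nonneg (c i * a i)]
  have hc : ∀ i, 7 / 8 ≤ c i := fun i => by
    have : 4 / 5 ≤ c i ^ 2 := by nlinarith [hc2 i, ha i, sq_nonneg (c i)]
    nlinarith [hc0 i]
  have hnorm : ∀ i, ‖c i • !₂[1, a i]‖ = 1 := by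
    intro i
    have h := EuclideanSpace.norm_sq_eq (c i • !₂[1, a i])
    simp [Fin.sum_univ_two, mul_pow] at h
    rw [← sq_eq_sq₀ (norm_nonneg _) zero_le_one, one_pow, h]
    nlinarith [hc2 i]
  have hsep : ∀ i j, i ≠ j → 3 / 4 * P⁻¹ ≤ c i * c j * |a i - a j| := by
    intro i j hij
    have h1 : P⁻¹ ≤ |a i - a j| := by
      have : a i - a j = (((i : ℕ) : ℝ) - ((j : ℕ) : ℝ)) / P := by simp only [a]; ring
      rw [this, abs_div, abs_of_pos hP0, inv_eq_one_div]
      gcongr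
      have h : (1 : ℤ) ≤ |((i : ℕ) : ℤ) - ((j : ℕ) : ℤ)| := by
        exact Int.one_le_abs (by simpa [sub_eq_zero, Fin.ext_iff] using hij)
      exact_mod_cast h
    have h2 : 3 / 4 ≤ c i * c j := by nlinarith [hc i, hc j]
    exact mul_le_mul h2 h1 (by positivity) (by nlinarith)
  refine ⟨3 / 4 * P⁻¹, by positivity, ?_, 2 ^ (2 * M), fun i => !₂[0, sawyer M (2 * M) i],
    fun i => c i • !₂[1, a i], hnorm, ?_, ?_, ?_⟩
  · have := inv_le_one_of_one_le₀ hP1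
    linarith
  · intro i j hij
    refine le_min ((hsep i j hij).trans ?_) ((hsep i j hij).trans ?_)
    · simpa using mul_abs_sub_le_norm_sub (a := a i) (hc0 i).le (hc0 j).le (hnorm j) 1
    · simpa using mul_abs_sub_le_norm_sub (a := a i) (hc0 i).le (hc0 j).le (hnorm j) (-1)
  · calc (1 : ℝ) ≤ ∑ _i : Fin (2 ^ (2 * M)), 7 / 8 * (2 * (3 / 4 * P⁻¹)) := by
          rw [Finset.sum_const, Finset.card_univ, Fintype.card_fin, nsmul_eq_mul]
          push_cast
          rw [← hP]
          field_simp
          norm_num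
      _ ≤ _ := Finset.sum_le_sum fun i _ => le_volume_tube (by norm_num) (hc i)
  · refine lt_of_le_of_lt (volume_iUnion_tube_le hM (by positivity) ?_ (fun i => (hc0 i).le) hc1) ?_
    · rw [one_div, inv_pow, ← hP]
      linarith [inv_pos.2 hP0]
    · rwa [div_lt_comm₀ hM' hη]
end

section
/- (Wolff) For every n ≥ 2, every Besicovitch set K ⊆ ℝⁿ has Hausdorff dimension at least (n+2)/2. -/
open MeasureTheory

namespace Kakeya

open Finset Module

/-- A finite set whose distinct points are at mutual distance at least `δ`. -/
def Sep {E : Type*} [NormedAddCommGroup E] (δ : ℝ) (X : Finset E) : Prop :=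
  ∀ p ∈ X, ∀ q ∈ X, p ≠ q → δ ≤ ‖p - q‖

theorem Sep.mono {E : Type*} [NormedAddCommGroup E] {δ : ℝ} {X Y : Finset E} (h : Sep δ X)
    (hY : Y ⊆ X) : Sep δ Y :=
  fun p hp q hq hpq => h p (hY hp) q (hY hq) hpq

/-- A finite set contains a maximal `δ`-separated subset. -/
theorem exists_sep_subset {E : Type*} [NormedAddCommGroup E] (X : Finset E) {δ : ℝ} (hδ : 0 < δ) :
    ∃ Z ⊆ X, Sep δ Z ∧ ∀ x ∈ X, ∃ z ∈ Z, ‖x - z‖ < δ := by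
  classical
  obtain ⟨Z, hZ⟩ := (X.powerset.filter (Sep δ)).exists_maximal ⟨∅, by simp [Sep]⟩
  obtain ⟨hmem, hmax⟩ := hZ
  rw [mem_filter, mem_powerset] at hmem
  refine ⟨Z, hmem.1, hmem.2, fun x hx => ?_⟩
  by_contra! hcon
  have hins : insert x Z ∈ X.powerset.filter (Sep δ) := by
    rw [mem_filter, mem_powerset]
    refine ⟨insert_subset hx hmem.1, ?_⟩
    intro p hp q hq hpq
    rw [mem_insert] at hp hq
    rcases hp with rfl | hp <;> rcases hq with rfl | hq
    · exact absurd rfl hpq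
    · exact hcon q hq
    · rw [norm_sub_rev]; exact hcon p hp
    · exact hmem.2 p hp q hq hpq
  have hxZ : x ∈ Z := hmax hins (subset_insert x Z) (mem_insert_self x Z)
  have := hcon x hxZ
  simp at this
  linarith

section Packing

variable {E : Type*} [NormedAddCommGroup E] [NormedSpace ℝ E] [FiniteDimensional ℝ E]

theorem Sep.card_le {δ : ℝ} (hδ : 0 < δ) {X : Finset E} (hX : Sep δ X) (c : E) {R : ℝ}
    (hR : 0 ≤ R) (hball : ∀ p ∈ X, ‖p - c‖ ≤ R * δ) :
    (X.card : ℝ) ≤ (2 * R + 1) ^ finrank ℝ E := by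
  borelize E
  let μ : Measure E := Measure.addHaar
  have D : Set.Pairwise (X : Set E) (Function.onFun Disjoint fun c => Metric.ball (c : E) (δ / 2)) := by
    rintro p hp q hq hpq
    apply Metric.ball_disjoint_ball
    rw [dist_eq_norm]
    linarith [hX p hp q hq hpq]
  have hsub : (⋃ p ∈ X, Metric.ball (p : E) (δ / 2)) ⊆ Metric.ball c ((R + 1 / 2) * δ) := by
    refine Set.iUnion₂_subset fun p hp => Metric.ball_subset_ball' ?_
    rw [dist_eq_norm]
    linarith [hball p hp]
  have hpos : 0 < (R + 1 / 2) * δ := by positivity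
  have I : (X.card : ENNReal) * ENNReal.ofReal ((δ / 2) ^ finrank ℝ E) * μ (Metric.ball 0 1) ≤
      ENNReal.ofReal (((R + 1 / 2) * δ) ^ finrank ℝ E) * μ (Metric.ball 0 1) :=
    calc
      _ = μ (⋃ p ∈ X, Metric.ball (p : E) (δ / 2)) := by
        rw [measure_biUnion_finset D fun c _ => measurableSet_ball]
        simp only [μ.addHaar_ball_of_pos _ (half_pos hδ)]
        simp only [Finset.sum_const, nsmul_eq_mul, mul_assoc]
      _ ≤ μ (Metric.ball c ((R + 1 / 2) * δ)) := measure_mono hsub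
      _ = _ := by simp only [μ.addHaar_ball_of_pos _ hpos]
  have J : (X.card : ENNReal) * ENNReal.ofReal ((δ / 2) ^ finrank ℝ E) ≤
      ENNReal.ofReal (((R + 1 / 2) * δ) ^ finrank ℝ E) :=
    (ENNReal.mul_le_mul_iff_left (Metric.measure_ball_pos _ _ zero_lt_one).ne'
      measure_ball_lt_top.ne).1 I
  have K := ENNReal.toReal_le_of_le_ofReal (by positivity) J
  rw [ENNReal.toReal_mul, ENNReal.toReal_natCast, ENNReal.toReal_ofReal (by positivity)] at K
  have h2 : ((R + 1 / 2) * δ) ^ finrank ℝ E = (2 * R + 1) ^ finrank ℝ E * (δ / 2) ^ finrank ℝ E := by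
    rw [← mul_pow]; congr 1; ring
  rw [h2] at K
  exact le_of_mul_le_mul_right K (by positivity)

/-- Packing along a one-dimensional parameter `f`. -/
theorem Sep.card_le_of_param {δ : ℝ} (hδ : 0 < δ) {X : Finset E} (hX : Sep δ X) (f : E → ℝ)
    {K L : ℝ} (hK : 1 ≤ K) (hL : 1 ≤ L)
    (hf : ∀ p ∈ X, ∀ q ∈ X, |f p - f q| ≤ δ → ‖p - q‖ ≤ K * δ)
    (hfL : ∀ p ∈ X, ∀ q ∈ X, |f p - f q| ≤ L * δ) :
    (X.card : ℝ) ≤ (3 * K) ^ finrank ℝ E * (2 * L) := by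
  classical
  rcases X.eq_empty_or_nonempty with rfl | hne
  · simp; positivity
  obtain ⟨p0, hp0, hmin⟩ := X.exists_min_image f hne
  have hfib : ∀ b ∈ range (⌊L⌋₊ + 1),
      {a ∈ X | ⌊(f a - f p0) / δ⌋₊ = b}.card ≤ ⌊(3 * K) ^ finrank ℝ E⌋₊ := by
    intro b _
    apply Nat.le_floor
    rcases ({a ∈ X | ⌊(f a - f p0) / δ⌋₊ = b}).eq_empty_or_nonempty with h0 | ⟨q, hq⟩
    · rw [h0]; simp; positivity
    refine ((hX.mono (filter_subset _ X)).card_le hδ q (R := K) (by linarith) ?_).trans ?_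
    · intro p hp
      rw [mem_filter] at hp hq
      apply hf p hp.1 q hq.1
      have e1 : 0 ≤ (f p - f p0) / δ := div_nonneg (by linarith [hmin p hp.1]) hδ.le
      have e2 : 0 ≤ (f q - f p0) / δ := div_nonneg (by linarith [hmin q hq.1]) hδ.le
      have a1 := Nat.floor_le e1
      have a2 := Nat.lt_floor_add_one ((f p - f p0) / δ)
      have a3 := Nat.floor_le e2
      have a4 := Nat.lt_floor_add_one ((f q - f p0) / δ)
      rw [hp.2] at a1 a2
      rw [hq.2] at a3 a4
      rw [le_div_iff₀ hδ] at a1 a3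
      rw [div_lt_iff₀ hδ] at a2 a4
      rw [abs_le]
      constructor <;> linarith
    · gcongr; linarith
  have hmaps : ∀ a ∈ X, ⌊(f a - f p0) / δ⌋₊ ∈ range (⌊L⌋₊ + 1) := by
    intro a ha
    rw [mem_range, Nat.lt_succ_iff]
    apply Nat.floor_le_floor
    rw [div_le_iff₀ hδ]
    exact (le_abs_self _).trans (hfL a ha p0 hp0)
  have h := card_le_mul_card_image_of_maps_to hmaps _ hfib
  rw [card_range] at h
  have h' : (X.card : ℝ) ≤ (⌊(3 * K) ^ finrank ℝ E⌋₊ : ℝ) * ((⌊L⌋₊ : ℝ) + 1) := by exact_mod_cast h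
  refine h'.trans ?_
  have b1 : (⌊(3 * K) ^ finrank ℝ E⌋₊ : ℝ) ≤ (3 * K) ^ finrank ℝ E := Nat.floor_le (by positivity)
  have b2 : (⌊L⌋₊ : ℝ) ≤ L := Nat.floor_le (by linarith)
  gcongr
  linarith

/-- Separated points of the unit sphere are counted by their codimension-one packing bound. -/
theorem Sep.card_le_of_unit {δ : ℝ} (hδ : 0 < δ) {X : Finset E} (hX : Sep δ X)
    (hunit : ∀ p ∈ X, ‖p‖ = 1) (c : E) {R : ℝ} (hR : 1 ≤ R)
    (hball : ∀ p ∈ X, ‖p - c‖ ≤ R * δ) :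
    (X.card : ℝ) * R ≤ (5 * R) ^ finrank ℝ E := by
  classical
  set m := ⌊R⌋₊ + 1 with hm
  have hmR : R ≤ m := by rw [hm]; push_cast; exact (Nat.lt_floor_add_one R).le
  set F : E × ℕ → E := fun x => (1 + x.2 * δ) • x.1 with hF
  have hsep : ∀ x ∈ X ×ˢ range m, ∀ y ∈ X ×ˢ range m, x ≠ y → δ ≤ ‖F x - F y‖ := by
    rintro ⟨e, k⟩ hx ⟨e', k'⟩ hy hxy
    rw [mem_product] at hx hy
    simp only [hF]
    by_cases hk : k = k'
    · subst hk
      have hee : e ≠ e' := fun h => hxy (by rw [h])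
      rw [← smul_sub, norm_smul, Real.norm_of_nonneg (by positivity)]
      have h1 := hX e hx.1 e' hy.1 hee
      have h2 : 0 ≤ (k : ℝ) * δ * ‖e - e'‖ := by positivity
      linarith
    · have h1 := abs_norm_sub_norm_le ((1 + k * δ) • e) ((1 + k' * δ) • e')
      rw [norm_smul, norm_smul, hunit e hx.1, hunit e' hy.1, Real.norm_of_nonneg (by positivity),
        Real.norm_of_nonneg (by positivity)] at h1
      refine le_trans ?_ h1
      have h2 : (1 + (k : ℝ) * δ) * 1 - (1 + k' * δ) * 1 = ((k : ℤ) - (k' : ℤ) : ℤ) * δ := by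
        push_cast; ring
      rw [h2, abs_mul, abs_of_pos hδ]
      have h3 : (1 : ℤ) ≤ |(k : ℤ) - k'| := Int.one_le_abs (by omega)
      have h4 : (1 : ℝ) ≤ |(((k : ℤ) - (k' : ℤ) : ℤ) : ℝ)| := by exact_mod_cast h3
      nlinarith
  have hinj : Set.InjOn F (X ×ˢ range m : Finset (E × ℕ)) := by
    intro x hx y hy hxy
    by_contra hne
    have := hsep x hx y hy hne
    rw [hxy, sub_self, norm_zero] at this
    linarith
  have hsep' : Sep δ ((X ×ˢ range m).image F) := by
    intro p hp q hq hpq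
    rw [mem_image] at hp hq
    obtain ⟨x, hx, rfl⟩ := hp
    obtain ⟨y, hy, rfl⟩ := hq
    exact hsep x hx y hy (fun h => hpq (by rw [h]))
  have h := hsep'.card_le hδ c (R := 2 * R) (by linarith) ?_
  · rw [card_image_of_injOn hinj, card_product, card_range] at h
    push_cast at h
    calc (X.card : ℝ) * R ≤ X.card * (m : ℝ) := by gcongr
      _ ≤ (2 * (2 * R) + 1) ^ finrank ℝ E := by exact_mod_cast h
      _ ≤ _ := by gcongr; linarith
  · intro p hp
    rw [mem_image] at hp
    obtain ⟨⟨e, k⟩, hx, rfl⟩ := hp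
    rw [mem_product, mem_range] at hx
    have hk : (k : ℝ) ≤ R := by
      have : k ≤ ⌊R⌋₊ := by have := hx.2; simp only at this; omega
      exact (Nat.cast_le.mpr this).trans (Nat.floor_le (by linarith))
    have : F (e, k) - c = (e - c) + (k * δ) • e := by
      simp only [hF, add_smul, one_smul]; abel
    rw [this]
    refine (norm_add_le _ _).trans ?_
    rw [norm_smul, hunit e hx.1, Real.norm_of_nonneg (by positivity)]
    have := hball e hx.1
    nlinarith

end Packing

section Geometry

variable {E : Type*} [NormedAddCommGroup E] [InnerProductSpace ℝ E]

/-- The points of `X` lie within `O(δ)` of a line with direction `e`. -/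
def AlongLine (δ : ℝ) (e : E) (X : Finset E) : Prop :=
  ∃ t : E → ℝ, ∀ p ∈ X, ∀ q ∈ X, ‖p - q - (t p - t q) • e‖ ≤ 4 * δ

theorem abs_mul_norm_sub_le {u v : E} (hu : ‖u‖ = 1) (hv : ‖v‖ = 1) (huv : ‖u - v‖ ≤ 1)
    (a b : ℝ) : |a| * ‖u - v‖ ≤ 2 * ‖a • u - b • v‖ := by
  have h1 : ‖u - v‖ ^ 2 = 2 - 2 * inner ℝ u v := by
    rw [norm_sub_sq_real, hu, hv]; ring
  have h2 : ‖a • u - b • v‖ ^ 2 = a ^ 2 - 2 * (a * b * inner ℝ u v) + b ^ 2 := by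
    rw [norm_sub_sq_real, norm_smul, norm_smul, hu, hv, inner_smul_left, inner_smul_right]
    simp only [mul_one, Real.norm_eq_abs, sq_abs, conj_trivial]; ring
  set c := inner ℝ u v with hc
  have hc1 : c ≤ 1 := by nlinarith [sq_nonneg ‖u - v‖]
  have hc0 : 0 ≤ c := by nlinarith [norm_nonneg (u - v)]
  apply le_of_sq_le_sq _ (by positivity)
  rw [mul_pow, mul_pow, sq_abs, h1, h2]
  nlinarith [sq_nonneg (b - a * c), mul_nonneg (sq_nonneg a) (mul_nonneg (sub_nonneg.2 hc1) hc0),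
    mul_nonneg (sq_nonneg a) (sub_nonneg.2 hc1)]

theorem exists_perp (u : E) {v : E} (hv : ‖v‖ = 1) :
    ∃ f : E, (‖f‖ = 1 ∨ f = 0) ∧ inner ℝ v f = 0 ∧ ∃ α γ : ℝ, u = α • v + γ • f := by
  set g := u - (inner ℝ v u : ℝ) • v with hg
  have hvg : inner ℝ v g = 0 := by
    rw [hg, inner_sub_right, inner_smul_right, real_inner_self_eq_norm_sq, hv]; ring
  by_cases h0 : g = 0
  · exact ⟨0, Or.inr rfl, by simp, inner ℝ v u, 0, by
      rw [hg] at h0; simpa using sub_eq_zero.1 h0⟩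
  · have hn : ‖g‖ ≠ 0 := norm_ne_zero_iff.2 h0
    refine ⟨‖g‖⁻¹ • g, Or.inl ?_, ?_, inner ℝ v u, ‖g‖, ?_⟩
    · rw [norm_smul, norm_inv, norm_norm, inv_mul_cancel₀ hn]
    · rw [inner_smul_right, hvg, mul_zero]
    · rw [smul_smul, mul_inv_cancel₀ hn, one_smul, hg]; abel

theorem norm_sub_proj_le {v f w : E} (hv : ‖v‖ = 1) (hf : ‖f‖ = 1 ∨ f = 0) (hvf : inner ℝ v f = 0)
    {a b ε : ℝ} (h : ‖w - (b • v + a • f)‖ ≤ ε) :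
    ‖w - ((inner ℝ v w : ℝ) • v + (inner ℝ f w : ℝ) • f)‖ ≤ ε := by
  set D := w - ((inner ℝ v w : ℝ) • v + (inner ℝ f w : ℝ) • f) with hD
  have hff : (inner ℝ f f : ℝ) * inner ℝ f w = inner ℝ f w := by
    rcases hf with hf | hf
    · rw [real_inner_self_eq_norm_sq, hf]; ring
    · simp [hf]
  have hfv : inner ℝ f v = 0 := by rw [real_inner_comm]; exact hvf
  have hDv : inner ℝ D v = 0 := by
    rw [real_inner_comm, hD, inner_sub_right, inner_add_right, inner_smul_right, inner_smul_right,
      hvf, real_inner_self_eq_norm_sq, hv]; ring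
  have hDf : inner ℝ D f = 0 := by
    rw [real_inner_comm, hD, inner_sub_right, inner_add_right, inner_smul_right, inner_smul_right,
      hfv, mul_comm (inner ℝ f w : ℝ) (inner ℝ f f), hff]; ring
  have hdec : w - (b • v + a • f) =
      D + ((inner ℝ v w - b : ℝ) • v + (inner ℝ f w - a : ℝ) • f) := by
    rw [hD, sub_smul, sub_smul]; abel
  have hort : inner ℝ D ((inner ℝ v w - b : ℝ) • v + (inner ℝ f w - a : ℝ) • f) = 0 := by
    rw [inner_add_right, inner_smul_right, inner_smul_right, hDv, hDf]; ring
  have := norm_add_sq_eq_norm_sq_add_norm_sq_of_inner_eq_zero _ _ hort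
  rw [← hdec] at this
  refine le_trans (le_of_sq_le_sq ?_ (norm_nonneg _)) h
  nlinarith [norm_nonneg ((inner ℝ v w - b : ℝ) • v + (inner ℝ f w - a : ℝ) • f)]

/-- Unit vectors near a common plane are determined by one coordinate. -/
theorem norm_sub_le_of_near_plane {v f w w' : E} (hv : ‖v‖ = 1) (hf : ‖f‖ = 1 ∨ f = 0)
    (hvf : inner ℝ v f = 0) (hw : ‖w‖ = 1) (hw' : ‖w'‖ = 1) (hwv : ‖w - v‖ ≤ 1)
    (hwv' : ‖w' - v‖ ≤ 1) {a b a' b' ε : ℝ} (hε : ε ≤ 1)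
    (h : ‖w - (b • v + a • f)‖ ≤ ε) (h' : ‖w' - (b' • v + a' • f)‖ ≤ ε) :
    ‖w - w'‖ ≤ 3 * ε + 3 * |inner ℝ f w - inner ℝ f w'| := by
  have hfn : ‖f‖ ≤ 1 := by rcases hf with hf | hf <;> simp [hf]
  have key : ∀ x : E, ‖x‖ = 1 → ‖x - v‖ ≤ 1 →
      ‖x - ((inner ℝ v x : ℝ) • v + (inner ℝ f x : ℝ) • f)‖ ^ 2 =
        1 - (inner ℝ v x) ^ 2 - (inner ℝ f x) ^ 2 ∧ 1 / 2 ≤ (inner ℝ v x : ℝ) ∧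
        |(inner ℝ f x : ℝ)| ≤ 1 := by
    intro x hx hxv
    refine ⟨?_, ?_, ?_⟩
    · have hff : (inner ℝ f x : ℝ) * (‖f‖ ^ 2 * inner ℝ f x) = (inner ℝ f x) ^ 2 := by
        rcases hf with hf | hf
        · rw [hf]; ring
        · simp [hf]
      rw [norm_sub_sq_real, norm_add_sq_real, inner_add_right, inner_smul_right, inner_smul_right,
        norm_smul, norm_smul, inner_smul_left, inner_smul_right, hvf, hx, hv,
        real_inner_comm v x, real_inner_comm f x, mul_pow, mul_pow, Real.norm_eq_abs,
        Real.norm_eq_abs, sq_abs, sq_abs]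
      linear_combination hff
    · have : ‖x - v‖ ^ 2 = 2 - 2 * inner ℝ v x := by
        rw [norm_sub_sq_real, hx, hv, real_inner_comm]; ring
      nlinarith [norm_nonneg (x - v)]
    · refine (abs_real_inner_le_norm f x).trans ?_
      rw [hx]; linarith
  obtain ⟨k1, k2, k3⟩ := key w hw hwv
  obtain ⟨k1', k2', k3'⟩ := key w' hw' hwv'
  have n1 := norm_sub_proj_le hv hf hvf h
  have n1' := norm_sub_proj_le hv hf hvf h'
  set D := w - ((inner ℝ v w : ℝ) • v + (inner ℝ f w : ℝ) • f) with hD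
  set D' := w' - ((inner ℝ v w' : ℝ) • v + (inner ℝ f w' : ℝ) • f) with hD'
  set α := (inner ℝ v w : ℝ)
  set α' := (inner ℝ v w' : ℝ)
  set β := (inner ℝ f w : ℝ)
  set β' := (inner ℝ f w' : ℝ)
  have hdec : w - w' = D - D' + ((α - α') • v + (β - β') • f) := by
    rw [hD, hD', sub_smul, sub_smul]; abel
  have hβ : |β ^ 2 - β' ^ 2| ≤ 2 * |β - β'| := by
    rw [show β ^ 2 - β' ^ 2 = (β + β') * (β - β') by ring, abs_mul]
    gcongr
    exact (abs_add_le _ _).trans (by linarith)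
  have hα : |α - α'| ≤ ε + 2 * |β - β'| := by
    have e1 : |α - α'| ≤ |α ^ 2 - α' ^ 2| := by
      rw [show α ^ 2 - α' ^ 2 = (α + α') * (α - α') by ring, abs_mul, abs_of_nonneg (by linarith : 0 ≤ α + α')]
      nlinarith [abs_nonneg (α - α')]
    have e2 : |α ^ 2 - α' ^ 2| ≤ ε + |β ^ 2 - β' ^ 2| := by
      have d1 : ‖D‖ ^ 2 ≤ ε := by nlinarith [norm_nonneg D]
      have d2 : ‖D'‖ ^ 2 ≤ ε := by nlinarith [norm_nonneg D']
      have d3 := sq_nonneg ‖D‖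
      have d4 := sq_nonneg ‖D'‖
      have d5 := le_abs_self (β ^ 2 - β' ^ 2)
      have d6 := neg_abs_le (β ^ 2 - β' ^ 2)
      rw [abs_le]
      constructor <;> linarith
    linarith
  calc ‖w - w'‖ ≤ ‖D‖ + ‖D'‖ + (|α - α'| * ‖v‖ + |β - β'| * ‖f‖) := by
        rw [hdec, ← Real.norm_eq_abs, ← Real.norm_eq_abs, ← norm_smul, ← norm_smul]
        exact (norm_add_le _ _).trans (add_le_add (norm_sub_le _ _) (norm_add_le _ _))
    _ ≤ ε + ε + ((ε + 2 * |β - β'|) * 1 + |β - β'| * 1) := by rw [hv]; gcongr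
    _ = _ := by ring

theorem AlongLine.subset {δ : ℝ} {e : E} {X Y : Finset E} (h : AlongLine δ e X) (hY : Y ⊆ X) :
    AlongLine δ e Y :=
  let ⟨t, ht⟩ := h
  ⟨t, fun p hp q hq => ht p (hY hp) q (hY hq)⟩

theorem AlongLine.card_le [FiniteDimensional ℝ E] {δ : ℝ} (hδ : 0 < δ) {e : E} (he : ‖e‖ = 1)
    {X : Finset E} (hX : Sep δ X) (hline : AlongLine δ e X) {R : ℝ} (hR : 1 ≤ R)
    (hdiam : ∀ p ∈ X, ∀ q ∈ X, ‖p - q‖ ≤ R * δ) :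
    (X.card : ℝ) ≤ 15 ^ finrank ℝ E * (10 * R) := by
  obtain ⟨t, ht⟩ := hline
  have h := hX.card_le_of_param hδ t (K := 5) (L := 5 * R) (by norm_num) (by linarith) ?_ ?_
  · refine h.trans (le_of_eq ?_)
    norm_num; ring
  · intro p hp q hq hpq
    have h1 := norm_add_le (p - q - (t p - t q) • e) ((t p - t q) • e)
    rw [sub_add_cancel, norm_smul, he, Real.norm_eq_abs] at h1
    linarith [ht p hp q hq]
  · intro p hp q hq
    have h1 := norm_sub_le (p - q) (p - q - (t p - t q) • e)
    rw [sub_sub_cancel, norm_smul, he, Real.norm_eq_abs] at h1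
    nlinarith [ht p hp q hq, hdiam p hp q hq]

theorem AlongLine.norm_sub_mul_le {δ : ℝ} {e e' : E} (he : ‖e‖ = 1) (he' : ‖e'‖ = 1)
    (hee : ‖e - e'‖ ≤ 1 / 2) {X : Finset E} (h : AlongLine δ e X) (h' : AlongLine δ e' X)
    {p q : E} (hp : p ∈ X) (hq : q ∈ X) : ‖p - q‖ * ‖e - e'‖ ≤ 18 * δ := by
  obtain ⟨t, ht⟩ := h
  obtain ⟨t', ht'⟩ := h'
  have h1 := ht p hp q hq
  have h2 := ht' p hp q hq
  have hδ : 0 ≤ δ := by linarith [(norm_nonneg _).trans h1]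
  set a := t p - t q
  set b := t' p - t' q
  have h3 := abs_mul_norm_sub_le he he' (by linarith) a b
  have h4 : ‖a • e - b • e'‖ ≤ 8 * δ := by
    have : a • e - b • e' = (p - q - b • e') - (p - q - a • e) := by abel
    rw [this]
    exact (norm_sub_le _ _).trans (by linarith)
  have h5 := norm_add_le (p - q - a • e) (a • e)
  rw [sub_add_cancel, norm_smul, he, Real.norm_eq_abs] at h5
  nlinarith [norm_nonneg (e - e')]

end Geometry

section Angle

variable {E : Type*} [NormedAddCommGroup E]

/-- The dyadic size of the separation of two directions, measured in units of `δ`. -/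
noncomputable def angleClass (δ : ℝ) (u v : E) : ℕ := Nat.size ⌊‖u - v‖ / δ⌋₊

theorem norm_sub_lt_of_angleClass {δ : ℝ} (hδ : 0 < δ) (u v : E) :
    ‖u - v‖ < 2 ^ angleClass δ u v * δ := by
  rw [← div_lt_iff₀ hδ]
  have h := Nat.lt_size_self ⌊‖u - v‖ / δ⌋₊
  have h' := (Nat.floor_lt (by positivity)).1 h
  simpa [angleClass] using h'

theorem le_norm_sub_of_angleClass {δ : ℝ} (hδ : 0 < δ) {u v : E} (h : angleClass δ u v ≠ 0) :
    2 ^ angleClass δ u v * δ ≤ 2 * ‖u - v‖ := by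
  obtain ⟨c, hc⟩ := Nat.exists_eq_succ_of_ne_zero h
  have h1 : c < Nat.size ⌊‖u - v‖ / δ⌋₊ := by
    have := hc; rw [angleClass] at this; omega
  have h2 := (Nat.le_floor_iff (by positivity)).1 (Nat.lt_size.1 h1)
  rw [le_div_iff₀ hδ] at h2
  rw [hc, pow_succ]
  push_cast at h2
  linarith

theorem angleClass_le {δ : ℝ} (hδ : 0 < δ) {u v : E} {S : ℕ} (hS : 1 / δ ≤ 2 ^ S)
    (h : ‖u - v‖ < 1) : angleClass δ u v ≤ S := by
  rw [angleClass, Nat.size_le, Nat.floor_lt (by positivity)]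
  push_cast
  refine lt_of_lt_of_le ?_ hS
  gcongr

end Angle

section Hairbrush

variable {E : Type*} [NormedAddCommGroup E] [InnerProductSpace ℝ E]

theorem card_inter_mul_le [DecidableEq E] [FiniteDimensional ℝ E] {δ : ℝ} (hδ : 0 < δ) (hδ1 : δ ≤ 1) {e e' : E}
    (he : ‖e‖ = 1) (he' : ‖e'‖ = 1) (hee : ‖e - e'‖ ≤ 1 / 2) {X Y : Finset E} (hX : Sep δ X)
    (hXe : AlongLine δ e X) (hYe : AlongLine δ e' Y) (hdiam : ∀ p ∈ X, ∀ q ∈ X, ‖p - q‖ ≤ 2) :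
    ((X ∩ Y).card : ℝ) * (2 ^ angleClass δ e e' * δ) ≤ 15 ^ finrank ℝ E * 360 := by
  have hs : Sep δ (X ∩ Y) := hX.mono inter_subset_left
  have h1 := hXe.subset (Y := X ∩ Y) inter_subset_left
  have h2 := hYe.subset (Y := X ∩ Y) inter_subset_right
  have hlt := norm_sub_lt_of_angleClass hδ e e'
  have hpos : 0 < 2 ^ angleClass δ e e' * δ := by positivity
  have hR : ∃ R : ℝ, 1 ≤ R ∧ R * (2 ^ angleClass δ e e' * δ) ≤ 36 ∧
      ∀ p ∈ X ∩ Y, ∀ q ∈ X ∩ Y, ‖p - q‖ ≤ R * δ := by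
    by_cases h0 : angleClass δ e e' = 0
    · rw [h0]
      refine ⟨2 / δ, ?_, ?_, ?_⟩
      · rw [le_div_iff₀ hδ]; linarith
      · rw [pow_zero, one_mul, div_mul_cancel₀ _ hδ.ne']; norm_num
      · intro p hp q hq
        rw [div_mul_cancel₀ _ hδ.ne']
        exact hdiam p (inter_subset_left hp) q (inter_subset_left hq)
    · have hge := le_norm_sub_of_angleClass hδ h0
      have hepos : 0 < ‖e - e'‖ := by linarith
      refine ⟨18 / ‖e - e'‖, ?_, ?_, ?_⟩
      · rw [le_div_iff₀ hepos]; linarith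
      · rw [div_mul_eq_mul_div, div_le_iff₀ hepos]; linarith
      · intro p hp q hq
        have := h1.norm_sub_mul_le he he' hee h2 hp hq
        rw [div_mul_eq_mul_div, le_div_iff₀ hepos]; exact this
  obtain ⟨R, hR1, hR2, hR3⟩ := hR
  have hc := h1.card_le hδ he hs hR1 hR3
  calc _ ≤ (15 ^ finrank ℝ E * (10 * R)) * (2 ^ angleClass δ e e' * δ) := by gcongr
    _ = 15 ^ finrank ℝ E * (10 * (R * (2 ^ angleClass δ e e' * δ))) := by ring
    _ ≤ 15 ^ finrank ℝ E * (10 * 36) := by gcongr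
    _ = _ := by norm_num

theorem exists_near_plane {δ r : ℝ} (hr : 8 * δ ≤ r) (hr0 : 0 < r) {u v w : E}
    (hw : ‖w‖ = 1) {X Y Z : Finset E} (hX : AlongLine δ u X) (hY : AlongLine δ v Y)
    (hZ : AlongLine δ w Z) {p p' q : E} (hpX : p ∈ X) (hpY : p ∈ Y) (hpX' : p' ∈ X) (hpZ' : p' ∈ Z)
    (hqY : q ∈ Y) (hqZ : q ∈ Z) (hqp : r ≤ ‖q - p'‖) :
    ∃ b a : ℝ, ‖w - (b • v + a • u)‖ ≤ 24 * δ / r := by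
  obtain ⟨tu, htu⟩ := hX
  obtain ⟨tv, htv⟩ := hY
  obtain ⟨tw, htw⟩ := hZ
  have h1 := htw q hqZ p' hpZ'
  have h2 := htv q hqY p hpY
  have h3 := htu p hpX p' hpX'
  set c := tw q - tw p'
  set b := tv q - tv p
  set a := tu p - tu p'
  have hc : r / 2 ≤ |c| := by
    have h5 := norm_add_le (q - p' - c • w) (c • w)
    rw [sub_add_cancel, norm_smul, hw, Real.norm_eq_abs] at h5
    linarith
  have hc0 : c ≠ 0 := by
    intro h; rw [h, abs_zero] at hc; linarith
  have h4 : ‖c • w - (b • v + a • u)‖ ≤ 12 * δ := by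
    have : c • w - (b • v + a • u) =
        (q - p - b • v) + (p - p' - a • u) - (q - p' - c • w) := by abel
    rw [this]
    refine (norm_sub_le _ _).trans ?_
    have := norm_add_le (q - p - b • v) (p - p' - a • u)
    linarith
  refine ⟨c⁻¹ * b, c⁻¹ * a, ?_⟩
  have : w - ((c⁻¹ * b) • v + (c⁻¹ * a) • u) = c⁻¹ • (c • w - (b • v + a • u)) := by
    rw [smul_sub, smul_add, smul_smul, smul_smul, smul_smul, inv_mul_cancel₀ hc0, one_smul]
  rw [this, norm_smul, norm_inv, Real.norm_eq_abs, inv_mul_le_iff₀ (abs_pos.2 hc0)]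
  rw [mul_div_assoc', le_div_iff₀ hr0]
  have hδ : 0 ≤ δ := by linarith [(norm_nonneg _).trans h1]
  nlinarith

variable [FiniteDimensional ℝ E]

/-- Directions close to a plane through `v` and making a small angle with `v`. -/
theorem Sep.card_le_near_plane {δ r : ℝ} (hδ : 0 < δ) (hr : 24 * δ ≤ r) (hr1 : r ≤ 1) {u v : E}
    (hv : ‖v‖ = 1) {H : Finset E} (hH : Sep δ H) (hunit : ∀ w ∈ H, ‖w‖ = 1)
    (hcap : ∀ w ∈ H, ‖w - v‖ ≤ 1)
    (hplane : ∀ w ∈ H, ∃ b a : ℝ, ‖w - (b • v + a • u)‖ ≤ 24 * δ / r) {R : ℝ} (hR : 1 ≤ R)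
    (hangle : ∀ w ∈ H, ‖v - w‖ ≤ R * δ) :
    (H.card : ℝ) ≤ (225 / r) ^ finrank ℝ E * (4 * R) := by
  obtain ⟨f, hf, hvf, α, γ, hu⟩ := exists_perp u hv
  have hr0 : 0 < r := by linarith
  have hfn : ‖f‖ ≤ 1 := by rcases hf with hf | hf <;> simp [hf]
  have hε : 24 * δ / r ≤ 1 := by rw [div_le_one hr0]; linarith
  have h := hH.card_le_of_param hδ (fun w => inner ℝ f w) (K := 75 / r) (L := 2 * R) ?_
    (by linarith) ?_ ?_
  · refine h.trans (le_of_eq ?_)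
    congr 1
    · congr 1; ring
    · ring
  · rw [le_div_iff₀ hr0]; linarith
  · intro p hp q hq hpq
    obtain ⟨b, a, hba⟩ := hplane p hp
    obtain ⟨b', a', hba'⟩ := hplane q hq
    have conv : ∀ b a : ℝ, b • v + a • u = (b + a * α) • v + (a * γ) • f := by
      intro b a
      rw [hu, smul_add, smul_smul, smul_smul, add_smul]; abel
    rw [conv] at hba hba'
    have := norm_sub_le_of_near_plane hv hf hvf (hunit p hp) (hunit q hq) (hcap p hp) (hcap q hq)
      hε hba hba'
    calc ‖p - q‖ ≤ 3 * (24 * δ / r) + 3 * δ := by linarith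
      _ ≤ 3 * (24 * δ / r) + 3 * δ / r := by
        gcongr
        rw [le_div_iff₀ hr0]; nlinarith
      _ = _ := by ring
  · intro p hp q hq
    have key : ∀ w ∈ H, |inner ℝ f w| ≤ R * δ := by
      intro w hw
      have e : (inner ℝ f w : ℝ) = inner ℝ f (w - v) := by
        rw [inner_sub_right, real_inner_comm v f, hvf, sub_zero]
      rw [e]
      refine (abs_real_inner_le_norm _ _).trans ?_
      have := hangle w hw
      rw [norm_sub_rev] at this
      nlinarith [norm_nonneg (w - v)]
    have := abs_sub (inner ℝ f p : ℝ) (inner ℝ f q)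
    have h1 := key p hp
    have h2 := key q hq
    linarith

/-- Cauchy–Schwarz for a family of finite sets with bounded overlaps. -/
theorem sq_mul_card_le_card_biUnion {ι α : Type*} [DecidableEq α] (H : Finset ι)
    (B : ι → Finset α) {β M : ℝ} (hβ : 0 ≤ β) (hB : ∀ j ∈ H, β ≤ (B j).card)
    (hM : ∀ j ∈ H, ∑ k ∈ H, ((B j ∩ B k).card : ℝ) ≤ M) :
    β ^ 2 * H.card ≤ (H.biUnion B).card * M := by
  classical
  rcases H.eq_empty_or_nonempty with rfl | hne
  · simp
  have hpos : (0 : ℝ) < H.card := by exact_mod_cast hne.card_pos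
  set U := H.biUnion B with hU
  have hcount : ∀ j ∈ H, ((B j).card : ℝ) = ∑ p ∈ U, if p ∈ B j then (1 : ℝ) else 0 := by
    intro j hj
    rw [sum_boole, filter_mem_eq_inter, inter_eq_right.2 (subset_biUnion_of_mem B hj)]
  have hcount2 : ∀ j ∈ H, ∀ k ∈ H, ((B j ∩ B k).card : ℝ) =
      ∑ p ∈ U, (if p ∈ B j then (1 : ℝ) else 0) * (if p ∈ B k then (1 : ℝ) else 0) := by
    intro j hj k hk
    have : ∀ p, (if p ∈ B j then (1 : ℝ) else 0) * (if p ∈ B k then (1 : ℝ) else 0) =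
        if p ∈ B j ∩ B k then 1 else 0 := by
      intro p; by_cases h1 : p ∈ B j <;> by_cases h2 : p ∈ B k <;> simp [h1, h2]
    simp only [this]
    rw [sum_boole, filter_mem_eq_inter,
      inter_eq_right.2 (inter_subset_left.trans (subset_biUnion_of_mem B hj))]
  have h1 : β * H.card ≤ ∑ p ∈ U, ∑ j ∈ H, if p ∈ B j then (1 : ℝ) else 0 := by
    rw [sum_comm, ← sum_congr rfl hcount, mul_comm, ← nsmul_eq_mul]
    exact card_nsmul_le_sum _ _ _ hB
  have h2 : ∑ p ∈ U, (∑ j ∈ H, if p ∈ B j then (1 : ℝ) else 0) ^ 2 ≤ H.card * M := by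
    have : ∑ p ∈ U, (∑ j ∈ H, if p ∈ B j then (1 : ℝ) else 0) ^ 2 =
        ∑ j ∈ H, ∑ k ∈ H, ((B j ∩ B k).card : ℝ) := by
      simp only [sq, sum_mul_sum]
      rw [sum_comm]
      refine sum_congr rfl fun j hj => ?_
      rw [sum_comm]
      exact sum_congr rfl fun k hk => (hcount2 j hj k hk).symm
    rw [this, ← nsmul_eq_mul]
    exact sum_le_card_nsmul _ _ _ hM
  have h3 := sq_sum_le_card_mul_sum_sq (s := U)
    (f := fun p => ∑ j ∈ H, if p ∈ B j then (1 : ℝ) else 0)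
  have h4 : (β * H.card) ^ 2 ≤ U.card * (H.card * M) :=
    (pow_le_pow_left₀ (by positivity) h1 2).trans (h3.trans (by gcongr))
  nlinarith

/-- The hairbrush estimate: line pieces `B j` which stay away from a common stem overlap little. -/
theorem card_hairbrush_le [DecidableEq E] {δ r : ℝ} (hδ : 0 < δ) (hr : 24 * δ ≤ r) (hr1 : r ≤ 1)
    {S : ℕ} (hS : 1 / δ ≤ 2 ^ S) {u : E} {X : Finset E} (hX : AlongLine δ u X)
    {H : Finset E} (hH : Sep δ H) (hunit : ∀ w ∈ H, ‖w‖ = 1)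
    (hcap : ∀ v ∈ H, ∀ w ∈ H, ‖v - w‖ ≤ 1 / 2) {A B : E → Finset E} (hA : ∀ j ∈ H, Sep δ (A j))
    (hline : ∀ j ∈ H, AlongLine δ j (A j))
    (hdiam : ∀ j ∈ H, ∀ p ∈ A j, ∀ q ∈ A j, ‖p - q‖ ≤ 2) (hBA : ∀ j ∈ H, B j ⊆ A j)
    (hstem : ∀ j ∈ H, ∃ p ∈ X ∩ A j, ∀ q ∈ B j, r ≤ ‖q - p‖) {β : ℝ} (hβ : 0 ≤ β)
    (hB : ∀ j ∈ H, β ≤ (B j).card) :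
    β ^ 2 * H.card ≤ (H.biUnion B).card *
      ((S + 1) * ((225 / r) ^ finrank ℝ E * 4 * (15 ^ finrank ℝ E * 360) / δ)) := by
  have hr0 : 0 < r := by linarith
  refine sq_mul_card_le_card_biUnion H B hβ hB fun j hj => ?_
  set H' := H.filter fun k => (B j ∩ B k).Nonempty with hH'
  have e1 : ∑ k ∈ H, ((B j ∩ B k).card : ℝ) = ∑ k ∈ H', ((B j ∩ B k).card : ℝ) := by
    rw [hH', sum_filter_of_ne]
    intro k _ hk
    rw [← card_pos]
    exact Nat.pos_of_ne_zero fun h => hk (by rw [h]; simp)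
  have hmaps : ∀ k ∈ H', angleClass δ j k ∈ range (S + 1) := by
    intro k hk
    rw [mem_range, Nat.lt_succ_iff]
    refine angleClass_le hδ hS ?_
    linarith [hcap j hj k (mem_filter.1 hk).1]
  rw [e1, ← sum_fiberwise_of_maps_to hmaps]
  refine (sum_le_card_nsmul (range (S + 1)) _
    ((225 / r) ^ finrank ℝ E * 4 * (15 ^ finrank ℝ E * 360) / δ) ?_).trans ?_
  swap
  · rw [card_range, nsmul_eq_mul]; push_cast; exact le_rfl
  intro c _
  have hterm : ∀ k ∈ H'.filter (fun k => angleClass δ j k = c), ((B j ∩ B k).card : ℝ) ≤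
      15 ^ finrank ℝ E * 360 / (2 ^ c * δ) := by
    intro k hk
    rw [mem_filter, mem_filter] at hk
    rw [le_div_iff₀ (by positivity), ← hk.2]
    refine le_trans ?_ (card_inter_mul_le hδ (by linarith) (hunit j hj) (hunit k hk.1.1)
      (hcap j hj k hk.1.1) (hA j hj) (hline j hj) (hline k hk.1.1) (hdiam j hj))
    gcongr
    · exact hBA j hj
    · exact hBA k hk.1.1
  have hcard : ((H'.filter (fun k => angleClass δ j k = c)).card : ℝ) ≤
      (225 / r) ^ finrank ℝ E * (4 * 2 ^ c) := by
    have hsub : H'.filter (fun k => angleClass δ j k = c) ⊆ H :=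
      (filter_subset _ _).trans (filter_subset _ _)
    refine (hH.mono hsub).card_le_near_plane hδ hr hr1 (u := u) (hunit j hj)
      (fun w hw => hunit w (hsub hw)) (fun w hw => ?_) (fun k hk => ?_) (one_le_pow₀ one_le_two)
      (fun w hw => ?_)
    · linarith [hcap w (hsub hw) j hj]
    · rw [mem_filter, mem_filter] at hk
      obtain ⟨q, hq⟩ := hk.1.2
      rw [mem_inter] at hq
      obtain ⟨p, hp, -⟩ := hstem j hj
      obtain ⟨p', hp', hpr⟩ := hstem k hk.1.1
      rw [mem_inter] at hp hp'
      exact exists_near_plane (by linarith) hr0 (hunit k hk.1.1) hX (hline j hj)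
        (hline k hk.1.1) hp.1 hp.2 hp'.1 hp'.2 (hBA j hj hq.1) (hBA k hk.1.1 hq.2) (hpr q hq.2)
    · rw [mem_filter] at hw
      rw [← hw.2]
      exact (norm_sub_lt_of_angleClass hδ j w).le
  refine (sum_le_card_nsmul _ _ _ hterm).trans ?_
  rw [nsmul_eq_mul]
  calc _ ≤ (225 / r) ^ finrank ℝ E * (4 * 2 ^ c) * (15 ^ finrank ℝ E * 360 / (2 ^ c * δ)) := by
        gcongr
    _ = _ := by field_simp

end Hairbrush

section Incidence

theorem exists_mul_card_le_sum_fiber {ι κ : Type*} [DecidableEq κ] {s : Finset ι} {t : Finset κ}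
    {f : ι → κ} (w : ι → ℝ) (hf : ∀ a ∈ s, f a ∈ t) (ht : t.Nonempty) :
    ∃ y ∈ t, ∑ x ∈ s, w x ≤ t.card * ∑ x ∈ s with f x = y, w x := by
  have hpos : (0 : ℝ) < t.card := by exact_mod_cast ht.card_pos
  obtain ⟨y, hy, h⟩ := exists_le_sum_fiber_of_maps_to_of_nsmul_le_sum (w := w)
    (b := (∑ x ∈ s, w x) / t.card) hf ht (by rw [nsmul_eq_mul, mul_div_cancel₀ _ hpos.ne'])
  exact ⟨y, hy, by rwa [div_le_iff₀' hpos] at h⟩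

theorem sum_card_filter_comm {α β : Type*} (s : Finset α) (t : Finset β) (r : α → β → Prop)
    [∀ a b, Decidable (r a b)] :
    ∑ a ∈ s, (((t.filter fun b => r a b).card : ℕ) : ℝ) =
      ∑ b ∈ t, (((s.filter fun a => r a b).card : ℕ) : ℝ) := by
  have h := sum_card_bipartiteAbove_eq_sum_card_bipartiteBelow r (s := s) (t := t)
  simp only [bipartiteAbove, bipartiteBelow] at h
  exact_mod_cast h

variable {E : Type*} [NormedAddCommGroup E] [InnerProductSpace ℝ E] [FiniteDimensional ℝ E]
  [DecidableEq E]

/-- The hairbrush estimate with all losses expressed through powers of one parameter `Λ`. -/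
theorem card_hairbrush_le_of_dense {δ Λ : ℝ} (hδ : 0 < δ) (hd : 2 ≤ finrank ℝ E) (hΛ : 10000000 ^ finrank ℝ E ≤ Λ)
    {S : ℕ} (hSΛ : S + 2 ≤ Λ) (hS : 1 / δ ≤ 2 ^ S) (hΛδ : Λ ^ 20 * δ ≤ 1)
    {u : E} {X : Finset E} (hX : AlongLine δ u X)
    {H : Finset E} (hH : Sep δ H) (hunit : ∀ w ∈ H, ‖w‖ = 1)
    (hcap : ∀ v ∈ H, ∀ w ∈ H, ‖v - w‖ ≤ 1 / 2) {A : E → Finset E} (hA : ∀ j ∈ H, Sep δ (A j))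
    (hline : ∀ j ∈ H, AlongLine δ j (A j))
    (hdiam : ∀ j ∈ H, ∀ p ∈ A j, ∀ q ∈ A j, ‖p - q‖ ≤ 2)
    (hstem : ∀ j ∈ H, (A j ∩ X).Nonempty) (hdense : ∀ j ∈ H, 1 ≤ Λ ^ 7 * δ * (A j).card) :
    (H.card : ℝ) ≤ Λ ^ (8 * finrank ℝ E + 17) * δ * (H.biUnion A).card := by
  set d := finrank ℝ E with hd'
  have hΛ1 : (10000000 : ℝ) ≤ Λ := (le_self_pow₀ (by norm_num) (by omega)).trans hΛ
  have hΛ0 : 0 < Λ := by linarith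
  have c1 : (15 : ℝ) ^ d * 40 ≤ Λ := by
    calc (15 : ℝ) ^ d * 40 ≤ 15 ^ d * 40 ^ d := by
          gcongr; exact le_self_pow₀ (by norm_num) (by omega)
      _ = 600 ^ d := by rw [← mul_pow]; norm_num
      _ ≤ 10000000 ^ d := by gcongr; norm_num
      _ ≤ Λ := hΛ
  have c2 : (225 : ℝ) ^ d * 15 ^ d * 1440 ≤ Λ := by
    calc (225 : ℝ) ^ d * 15 ^ d * 1440 ≤ 225 ^ d * 15 ^ d * 1440 ^ d := by
          gcongr; exact le_self_pow₀ (by norm_num) (by omega)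
      _ = 4860000 ^ d := by rw [← mul_pow, ← mul_pow]; norm_num
      _ ≤ 10000000 ^ d := by gcongr; norm_num
      _ ≤ Λ := hΛ
  choose! p hp using hstem
  set r : ℝ := (Λ ^ 8)⁻¹ with hr
  have hr0 : 0 < r := by positivity
  have hr1 : r ≤ 1 := inv_le_one_of_one_le₀ (one_le_pow₀ (by linarith))
  have hrδ : 24 * δ ≤ r := by
    rw [hr, le_inv_comm₀ (by positivity) (by positivity), ← one_div, le_div_iff₀ (by positivity)]
    calc Λ ^ 8 * (24 * δ) ≤ Λ ^ 8 * (Λ ^ 12 * δ) := by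
          gcongr
          exact (by linarith : (24 : ℝ) ≤ Λ).trans (le_self_pow₀ (by linarith) (by norm_num))
      _ = Λ ^ 20 * δ := by ring
      _ ≤ 1 := hΛδ
  set B : E → Finset E := fun j => (A j).filter fun q => r ≤ ‖q - p j‖ with hB
  set β : ℝ := (2 * Λ ^ 7 * δ)⁻¹ with hβ
  have hBcard : ∀ j ∈ H, β ≤ (B j).card := by
    intro j hj
    have hsplit := card_filter_add_card_filter_not (s := A j) (fun q => r ≤ ‖q - p j‖)
    have hsplit' : ((B j).card : ℝ) + ((A j).filter fun q => ¬ r ≤ ‖q - p j‖).card = (A j).card := by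
      exact_mod_cast hsplit
    have hnear : (((A j).filter fun q => ¬ r ≤ ‖q - p j‖).card : ℝ) ≤ 15 ^ d * (10 * (2 * r / δ)) := by
      refine ((hline j hj).subset (filter_subset _ _)).card_le hδ (hunit j hj)
        ((hA j hj).mono (filter_subset _ _)) ?_ ?_
      · rw [le_div_iff₀ hδ]; linarith
      · intro a ha b hb
        rw [mem_filter, not_le] at ha hb
        rw [div_mul_cancel₀ _ hδ.ne']
        have := norm_sub_le (a - p j) (b - p j)
        rw [sub_sub_sub_cancel_right] at this
        linarith
    have hnear2 : 15 ^ d * (10 * (2 * r / δ)) ≤ β := by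
      calc (15 : ℝ) ^ d * (10 * (2 * r / δ)) = (15 ^ d * 40) * (r / (2 * δ)) := by ring
        _ ≤ Λ * (r / (2 * δ)) := by gcongr
        _ = β := by rw [hr, hβ]; field_simp
    have hbig : 2 * β ≤ (A j).card := by
      have h2 : 2 * β = 1 / (Λ ^ 7 * δ) := by rw [hβ]; field_simp
      rw [h2, div_le_iff₀' (by positivity)]
      exact hdense j hj
    linarith
  have h := card_hairbrush_le (A := A) (B := B) hδ hrδ hr1 hS hX hH hunit hcap hA hline hdiam
    (fun j _ => filter_subset _ _) (fun j hj => ⟨p j, by rw [inter_comm]; exact hp j hj, fun q hq => (mem_filter.1 hq).2⟩)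
    (by positivity) hBcard
  have hU : ((H.biUnion B).card : ℝ) ≤ (H.biUnion A).card := by
    exact_mod_cast card_le_card (biUnion_mono fun j _ => filter_subset _ _)
  have hM : ((S : ℝ) + 1) * ((225 / r) ^ d * 4 * (15 ^ d * 360) / δ) ≤ Λ ^ (8 * d + 2) / δ := by
    calc ((S : ℝ) + 1) * ((225 / r) ^ d * 4 * (15 ^ d * 360) / δ)
        = ((S : ℝ) + 1) * ((225 ^ d * 15 ^ d * 1440) * Λ ^ (8 * d) / δ) := by
          rw [hr, div_inv_eq_mul, mul_pow, ← pow_mul]; ring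
      _ ≤ Λ * (Λ * Λ ^ (8 * d) / δ) := by gcongr; linarith
      _ = _ := by rw [pow_add]; ring
  have h2 : β ^ 2 * H.card ≤ (H.biUnion A).card * (Λ ^ (8 * d + 2) / δ) :=
    h.trans (by gcongr)
  calc (H.card : ℝ) = (2 * Λ ^ 7 * δ) ^ 2 * (β ^ 2 * H.card) := by rw [hβ]; field_simp
    _ ≤ (2 * Λ ^ 7 * δ) ^ 2 * ((H.biUnion A).card * (Λ ^ (8 * d + 2) / δ)) := by gcongr
    _ = 4 * (Λ ^ (8 * d + 16) * δ * (H.biUnion A).card) := by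
        rw [pow_add Λ (8 * d) 2, pow_add Λ (8 * d) 16, mul_div_assoc', mul_div_assoc',
          div_eq_iff hδ.ne']
        ring
    _ ≤ Λ * (Λ ^ (8 * d + 16) * δ * (H.biUnion A).card) := by gcongr; linarith
    _ = _ := by rw [pow_succ Λ (8 * d + 16)]; ring

/-- The members of the family `A` which contain `p`. -/
def through (A : E → Finset E) (I : Finset E) (p : E) : Finset E := I.filter fun e => p ∈ A e

/-- The number of members of the family through `p` making an angle of class `c` with `e`. -/
noncomputable def coneCard (δ : ℝ) (A : E → Finset E) (I : Finset E) (c : ℕ) (p e : E) : ℝ :=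
  ((through A I p).filter fun e' => angleClass δ e e' = c).card

omit [NormedAddCommGroup E] [InnerProductSpace ℝ E] [FiniteDimensional ℝ E] in
theorem sum_card_eq_sum_through (A : E → Finset E) (I P : Finset E) (hA : ∀ e ∈ I, A e ⊆ P) :
    ∑ e ∈ I, ((A e).card : ℝ) = ∑ p ∈ P, ((through A I p).card : ℝ) := by
  rw [show ∑ p ∈ P, ((through A I p).card : ℝ) =
    ∑ p ∈ P, (((I.filter fun e => p ∈ A e).card : ℕ) : ℝ) from rfl, sum_card_filter_comm]
  refine sum_congr rfl fun e he => ?_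
  rw [filter_mem_eq_inter, inter_eq_right.2 (hA e he)]

omit [NormedAddCommGroup E] [InnerProductSpace ℝ E] [FiniteDimensional ℝ E] in
theorem exists_multiplicity_level (A : E → Finset E) (I P : Finset E) (hA : ∀ e ∈ I, A e ⊆ P)
    {K : ℕ} (hK : I.card < 2 ^ K) (hpos : 0 < ∑ e ∈ I, ((A e).card : ℝ)) :
    ∃ N : ℝ, 0 < N ∧ ∃ P' ⊆ P,
      (∀ p ∈ P', N ≤ (through A I p).card ∧ ((through A I p).card : ℝ) ≤ 2 * N) ∧
      ∑ e ∈ I, ((A e).card : ℝ) ≤ (K + 1) * ∑ p ∈ P', ((through A I p).card : ℝ) := by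
  rw [sum_card_eq_sum_through A I P hA] at hpos ⊢
  obtain ⟨a, -, ha⟩ := exists_mul_card_le_sum_fiber (s := P) (t := range (K + 1))
    (f := fun p => Nat.size (through A I p).card) (fun p => ((through A I p).card : ℝ))
    (fun p _ => by
      rw [mem_range, Nat.lt_succ_iff, Nat.size_le]
      exact (card_le_card (filter_subset _ _)).trans_lt hK) ⟨0, by simp⟩
  rw [card_range] at ha
  push_cast at ha
  have ha0 : a ≠ 0 := by
    rintro rfl
    refine absurd ha (not_le.2 ?_)
    rw [sum_eq_zero, mul_zero]
    · exact hpos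
    · intro p hp
      rw [mem_filter, Nat.size_eq_zero] at hp
      exact_mod_cast hp.2
  obtain ⟨b, rfl⟩ := Nat.exists_eq_succ_of_ne_zero ha0
  refine ⟨2 ^ b, by positivity, _, filter_subset _ _, fun p hp => ?_, ha⟩
  rw [mem_filter] at hp
  constructor
  · have : b < Nat.size (through A I p).card := by rw [hp.2]; exact Nat.lt_succ_self b
    exact_mod_cast Nat.lt_size.1 this
  · have := Nat.lt_size_self (through A I p).card
    rw [hp.2, Nat.pow_succ'] at this
    exact_mod_cast this.le

omit [InnerProductSpace ℝ E] [FiniteDimensional ℝ E] in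
theorem exists_angleClass (A : E → Finset E) (I P : Finset E) {δ N : ℝ} (hδ : 0 < δ) {S : ℕ}
    (hS : 1 / δ ≤ 2 ^ S) (hcap : ∀ v ∈ I, ∀ w ∈ I, ‖v - w‖ ≤ 1 / 2)
    (hN : ∀ p ∈ P, N ≤ (through A I p).card) :
    ∃ c : ℕ, N * ∑ p ∈ P, ((through A I p).card : ℝ) ≤
      (S + 1) * ∑ p ∈ P, ∑ e ∈ through A I p, coneCard δ A I c p e := by
  have hfib : ∀ p ∈ P, ∀ e ∈ through A I p, ((through A I p).card : ℝ) =
      ∑ c ∈ range (S + 1), coneCard δ A I c p e := by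
    intro p _ e he
    have := card_eq_sum_card_fiberwise (s := through A I p) (f := fun e' => angleClass δ e e')
      (t := range (S + 1)) (fun e' he' => by
        rw [mem_coe, mem_range, Nat.lt_succ_iff]
        refine angleClass_le hδ hS ?_
        linarith [hcap e (mem_filter.1 he).1 e' (mem_filter.1 he').1])
    simp only [coneCard]
    exact_mod_cast this
  have hsum : N * ∑ p ∈ P, ((through A I p).card : ℝ) ≤
      ∑ c ∈ range (S + 1), ∑ p ∈ P, ∑ e ∈ through A I p, coneCard δ A I c p e := by
    rw [sum_comm, mul_sum]
    refine sum_le_sum fun p hp => ?_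
    rw [sum_comm, ← sum_congr rfl (hfib p hp), sum_const, nsmul_eq_mul]
    gcongr
    exact hN p hp
  obtain ⟨c, -, hc⟩ := exists_le_of_sum_le (s := range (S + 1))
    (f := fun _ => (N * ∑ p ∈ P, ((through A I p).card : ℝ)) / (S + 1)) ⟨0, by simp⟩
    (le_trans (le_of_eq (by
      rw [sum_const, card_range, nsmul_eq_mul]; push_cast; field_simp)) hsum)
  exact ⟨c, by rwa [div_le_iff₀' (by positivity)] at hc⟩

omit [InnerProductSpace ℝ E] [FiniteDimensional ℝ E] in
/-- Passing to lines which carry many points with a rich cone of class `c`. -/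
theorem sum_coneCard_dense (A : E → Finset E) (I P : Finset E) {δ Λ N D : ℝ} (hδ : 0 < δ)
    (hD : 0 < D) (hN : 0 < N) (hΛ : 8 ≤ Λ) (c : ℕ)
    (hP : ∀ p ∈ P, ((through A I p).card : ℝ) ≤ 2 * N)
    (hW : 1 ≤ Λ ^ 4 * D * ∑ p ∈ P, ((through A I p).card : ℝ))
    (hI : I.card * D ≤ Λ * δ)
    (hc : N * ∑ p ∈ P, ((through A I p).card : ℝ) ≤
      Λ * ∑ p ∈ P, ∑ e ∈ through A I p, coneCard δ A I c p e)
    (A' : E → Finset E)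
    (hA' : ∀ e, A' e = P.filter fun p => p ∈ A e ∧ N ≤ 4 * Λ * coneCard δ A I c p e) :
    N * ∑ p ∈ P, ((through A I p).card : ℝ) ≤
      2 * Λ * ∑ e ∈ I with 1 ≤ Λ ^ 7 * δ * (A' e).card, ∑ p ∈ A' e, coneCard δ A I c p e := by
  set W := ∑ p ∈ P, ((through A I p).card : ℝ) with hWdef
  have hΛ0 : 0 < Λ := by linarith
  have hcone : ∀ p e, 0 ≤ coneCard δ A I c p e := fun p e => Nat.cast_nonneg _
  have hcone2 : ∀ p ∈ P, ∀ e, coneCard δ A I c p e ≤ 2 * N := fun p hp e =>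
    le_trans (by unfold coneCard; exact_mod_cast card_le_card (filter_subset _ _)) (hP p hp)
  have hswap : ∑ p ∈ P, ∑ e ∈ through A I p, coneCard δ A I c p e =
      ∑ e ∈ I, ∑ p ∈ P with p ∈ A e, coneCard δ A I c p e := by
    simp only [through, sum_filter]
    rw [sum_comm]
  have hswap2 : W = ∑ e ∈ I, ((P.filter fun p => p ∈ A e).card : ℝ) := by
    rw [hWdef]
    exact sum_card_filter_comm P I fun p e => p ∈ A e
  have hline : ∀ e ∈ I, ∑ p ∈ P with p ∈ A e, coneCard δ A I c p e ≤
      ∑ p ∈ A' e, coneCard δ A I c p e + N / (4 * Λ) * (P.filter fun p => p ∈ A e).card := by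
    intro e _
    rw [← sum_filter_add_sum_filter_not (P.filter fun p => p ∈ A e)
      (fun p => N ≤ 4 * Λ * coneCard δ A I c p e), filter_filter, ← hA']
    gcongr
    refine (sum_le_card_nsmul _ _ (N / (4 * Λ)) fun p hp => ?_).trans ?_
    · rw [mem_filter, not_le] at hp
      rw [le_div_iff₀ (by positivity)]
      linarith [hp.2]
    · rw [nsmul_eq_mul, mul_comm]
      gcongr
      exact filter_subset _ _
  have hsum : ∑ e ∈ I, ∑ p ∈ P with p ∈ A e, coneCard δ A I c p e ≤
      ∑ e ∈ I, ∑ p ∈ A' e, coneCard δ A I c p e + N / (4 * Λ) * W := by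
    rw [hswap2, mul_sum, ← sum_add_distrib]
    exact sum_le_sum hline
  rw [hswap] at hc
  clear hswap
  clear_value W
  clear hswap2 hline
  have hbad : ∑ e ∈ I with ¬ 1 ≤ Λ ^ 7 * δ * (A' e).card, ∑ p ∈ A' e, coneCard δ A I c p e ≤
      N / (4 * Λ) * W := by
    have h1 : ∀ e ∈ I.filter (fun e => ¬ 1 ≤ Λ ^ 7 * δ * (A' e).card),
        ∑ p ∈ A' e, coneCard δ A I c p e ≤ 2 * N / (Λ ^ 7 * δ) := by
      intro e he
      rw [mem_filter, not_le] at he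
      refine (sum_le_card_nsmul _ _ (2 * N) fun p hp => ?_).trans ?_
      · rw [hA', mem_filter] at hp
        exact hcone2 p hp.1 e
      · rw [nsmul_eq_mul, le_div_iff₀ (by positivity)]
        nlinarith [he.2]
    refine (sum_le_card_nsmul _ _ _ h1).trans ?_
    rw [nsmul_eq_mul]
    have h2 : ((I.filter (fun e => ¬ 1 ≤ Λ ^ 7 * δ * (A' e).card)).card : ℝ) ≤ Λ * δ / D := by
      rw [le_div_iff₀ hD]
      refine le_trans ?_ hI
      gcongr
      exact filter_subset _ _
    have h3 : (Λ ^ 4 * D)⁻¹ ≤ W := by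
      rw [inv_le_iff_one_le_mul₀' (by positivity)]; exact hW
    have hW0 : 0 ≤ W := le_trans (by positivity) h3
    calc _ ≤ Λ * δ / D * (2 * N / (Λ ^ 7 * δ)) := by gcongr
      _ = N / (4 * Λ) * ((Λ ^ 4 * D)⁻¹ * (8 / Λ)) := by field_simp; norm_num
      _ ≤ N / (4 * Λ) * (W * 1) := by
        gcongr
        rw [div_le_one hΛ0]; exact hΛ
      _ = _ := by rw [mul_one]
  have hsplit := sum_filter_add_sum_filter_not I (fun e => 1 ≤ Λ ^ 7 * δ * ((A' e).card : ℝ))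
    (fun e => ∑ p ∈ A' e, coneCard δ A I c p e)
  set G := ∑ e ∈ I with 1 ≤ Λ ^ 7 * δ * (A' e).card, ∑ p ∈ A' e, coneCard δ A I c p e
  have h4 : N * W ≤ Λ * (G + N / (4 * Λ) * W + N / (4 * Λ) * W) := by
    refine hc.trans ?_
    gcongr
    linarith
  have h5 : Λ * (G + N / (4 * Λ) * W + N / (4 * Λ) * W) = Λ * G + N * W / 2 := by
    field_simp; ring
  linarith

/-- Double counting of the incidences between rich cones and lines. -/
theorem sum_coneCard_mul_le {A A' : E → Finset E} {I J : Finset E} {δ Λ : ℝ} (hδ : 0 < δ)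
    (hδ1 : δ ≤ 1) (hΛ : 15 ^ finrank ℝ E * 360 ≤ Λ) (hJ : J ⊆ I) (hunit : ∀ v ∈ I, ‖v‖ = 1)
    (hcap : ∀ v ∈ I, ∀ w ∈ I, ‖v - w‖ ≤ 1 / 2) (hA : ∀ e ∈ I, Sep δ (A e))
    (hline : ∀ e ∈ I, AlongLine δ e (A e)) (hdiam : ∀ e ∈ I, ∀ p ∈ A e, ∀ q ∈ A e, ‖p - q‖ ≤ 2)
    (hA' : ∀ e, A' e ⊆ A e) (c : ℕ) :
    (∑ j ∈ J, ∑ p ∈ A' j, coneCard δ A I c p j) * (2 ^ c * δ) ≤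
      Λ * ∑ i ∈ I, ((J.filter fun j => angleClass δ j i = c ∧ (A' j ∩ A i).Nonempty).card : ℝ) := by
  have h1 : ∀ j ∈ J, ∑ p ∈ A' j, coneCard δ A I c p j =
      ∑ i ∈ I with angleClass δ j i = c, ((A' j ∩ A i).card : ℝ) := by
    intro j _
    have := sum_card_filter_comm (A' j) (I.filter fun i => angleClass δ j i = c)
      fun p i => p ∈ A i
    simp only [coneCard, through]
    simp only [filter_mem_eq_inter] at this
    rw [← this]
    refine sum_congr rfl fun p _ => ?_
    rw [filter_filter, filter_filter]
    congr 3
    ext i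
    rw [and_comm]
  rw [sum_congr rfl h1, sum_mul]
  have h2 : ∀ j ∈ J, (∑ i ∈ I with angleClass δ j i = c, ((A' j ∩ A i).card : ℝ)) * (2 ^ c * δ) ≤
      Λ * (I.filter fun i => angleClass δ j i = c ∧ (A' j ∩ A i).Nonempty).card := by
    intro j hj
    rw [← filter_filter, sum_mul, ← sum_filter_add_sum_filter_not
      (I.filter fun i => angleClass δ j i = c) (fun i => (A' j ∩ A i).Nonempty)]
    rw [sum_eq_zero (s := filter (fun i => ¬(A' j ∩ A i).Nonempty) _) (fun i hi => by
      rw [mem_filter, not_nonempty_iff_eq_empty] at hi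
      simp [hi.2]), add_zero]
    refine (sum_le_card_nsmul _ _ Λ fun i hi => ?_).trans (le_of_eq (by rw [nsmul_eq_mul, mul_comm]))
    rw [mem_filter, mem_filter] at hi
    have hjI := hJ hj
    refine le_trans ?_ hΛ
    rw [← hi.1.2]
    exact card_inter_mul_le hδ hδ1 (hunit j hjI) (hunit i hi.1.1) (hcap j hjI i hi.1.1)
      ((hA j hjI).mono (hA' j)) ((hline j hjI).subset (hA' j)) (hline i hi.1.1)
      fun p hp q hq => hdiam j hjI p (hA' j hp) q (hA' j hq)
  refine (sum_le_sum h2).trans (le_of_eq ?_)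
  rw [← mul_sum]
  congr 1
  exact sum_card_filter_comm J I fun j i => angleClass δ j i = c ∧ (A' j ∩ A i).Nonempty

omit [DecidableEq E] in
/-- A bounded function on `δ`-separated directions is controlled by its values at one point of
each `sδ`-cell. -/
theorem exists_cell_representatives {I : Finset E} {δ s : ℝ} (hδ : 0 < δ) (hs : 1 ≤ s)
    (hI : Sep δ I) (hunit : ∀ v ∈ I, ‖v‖ = 1) {h : E → ℝ} (hh : ∀ i, 0 ≤ h i) :
    ∃ Z ⊆ I, Sep (s * δ) Z ∧ ∃ f : E → E, (∀ z ∈ Z, f z ∈ I ∧ ‖f z - z‖ < s * δ) ∧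
      (∑ i ∈ I, h i) * s ≤ (5 * s) ^ finrank ℝ E * ∑ z ∈ Z, h (f z) := by
  have hsδ : 0 < s * δ := by positivity
  obtain ⟨Z, hZI, hZ, hcov⟩ := exists_sep_subset I hsδ
  have hmax : ∀ z ∈ Z, ∃ i, (i ∈ I ∧ ‖i - z‖ < s * δ) ∧
      ∀ j ∈ I, ‖j - z‖ < s * δ → h j ≤ h i := by
    intro z hz
    obtain ⟨i, hi, him⟩ := exists_max_image (I.filter fun i => ‖i - z‖ < s * δ) h
      ⟨z, by rw [mem_filter, sub_self, norm_zero]; exact ⟨hZI hz, hsδ⟩⟩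
    rw [mem_filter] at hi
    exact ⟨i, hi, fun j hj hjz => him j (mem_filter.2 ⟨hj, hjz⟩)⟩
  choose! f hf hfmax using hmax
  refine ⟨Z, hZI, hZ, f, hf, ?_⟩
  have h1 : ∑ i ∈ I, h i ≤ ∑ z ∈ Z, ∑ i ∈ I with ‖i - z‖ < s * δ, h i := by
    simp only [sum_filter]
    rw [sum_comm]
    refine sum_le_sum fun i hi => ?_
    obtain ⟨z, hz, hiz⟩ := hcov i hi
    refine le_trans (le_of_eq ?_) (single_le_sum (f := fun z => if ‖i - z‖ < s * δ then h i else 0)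
      (fun z _ => ?_) hz)
    · simp [hiz]
    · split_ifs
      exacts [hh i, le_rfl]
  calc (∑ i ∈ I, h i) * s ≤ (∑ z ∈ Z, ∑ i ∈ I with ‖i - z‖ < s * δ, h i) * s := by gcongr
    _ = ∑ z ∈ Z, (∑ i ∈ I with ‖i - z‖ < s * δ, h i) * s := sum_mul _ _ _
    _ ≤ ∑ z ∈ Z, (5 * s) ^ finrank ℝ E * h (f z) := by
      refine sum_le_sum fun z hz => ?_
      have h2 : ∑ i ∈ I with ‖i - z‖ < s * δ, h i ≤
          (I.filter fun i => ‖i - z‖ < s * δ).card * h (f z) := by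
        rw [← nsmul_eq_mul]
        refine sum_le_card_nsmul _ _ _ fun i hi => ?_
        rw [mem_filter] at hi
        exact hfmax z hz i hi.1 hi.2
      have h3 := (hI.mono (filter_subset (fun i => ‖i - z‖ < s * δ) I)).card_le_of_unit hδ
        (fun i hi => hunit i (mem_filter.1 hi).1) z hs fun i hi => (mem_filter.1 hi).2.le
      calc _ ≤ ((I.filter fun i => ‖i - z‖ < s * δ).card * h (f z)) * s := by gcongr
        _ = ((I.filter fun i => ‖i - z‖ < s * δ).card * s) * h (f z) := by ring
        _ ≤ _ := by gcongr; exact hh _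
    _ = _ := (mul_sum _ _ _).symm

/-- Hairbrushes whose stems point in separated directions have bounded overlap. -/
theorem sum_card_biUnion_le {A A' : E → Finset E} {I P Z : Finset E} {H : E → Finset E}
    {δ Λ N : ℝ} (hδ : 0 < δ) (hN : 0 < N) (hΛ : 8 * 7 ^ finrank ℝ E ≤ Λ) {c : ℕ}
    (hP : ∀ p ∈ P, ((through A I p).card : ℝ) ≤ 2 * N)
    (hA' : ∀ e, A' e ⊆ P) (hrich : ∀ e, ∀ p ∈ A' e, N ≤ 4 * Λ * coneCard δ A I c p e)
    (hZ : Sep (2 ^ c * δ) Z)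
    (hH : ∀ z ∈ Z, ∀ j ∈ H z, ∃ i, angleClass δ j i = c ∧ ‖i - z‖ < 2 ^ c * δ) :
    ∑ z ∈ Z, (((H z).biUnion A').card : ℝ) ≤ Λ ^ 2 * P.card := by
  have hσ : (0 : ℝ) < 2 ^ c * δ := by positivity
  have hΛ0 : 0 < Λ := lt_of_lt_of_le (by positivity) hΛ
  have h1 : ∑ z ∈ Z, (((H z).biUnion A').card : ℝ) =
      ∑ p ∈ P, ((Z.filter fun z => p ∈ (H z).biUnion A').card : ℝ) := by
    rw [← sum_card_filter_comm Z P fun z p => p ∈ (H z).biUnion A']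
    refine sum_congr rfl fun z _ => ?_
    rw [filter_mem_eq_inter, inter_eq_right.2 (biUnion_subset.2 fun j _ => hA' j)]
  rw [h1, mul_comm, ← nsmul_eq_mul]
  refine sum_le_card_nsmul _ _ _ fun p hp => ?_
  set Zp := Z.filter fun z => p ∈ (H z).biUnion A' with hZp
  have h2 : ∀ z ∈ Zp, N ≤ 4 * Λ *
      ((through A I p).filter fun e => ‖z - e‖ ≤ 3 * (2 ^ c * δ)).card := by
    intro z hz
    rw [hZp, mem_filter, mem_biUnion] at hz
    obtain ⟨hzZ, j, hj, hpj⟩ := hz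
    obtain ⟨i, hji, hiz⟩ := hH z hzZ j hj
    refine (hrich j p hpj).trans ?_
    refine mul_le_mul_of_nonneg_left ?_ (by positivity)
    unfold coneCard
    refine Nat.cast_le.2 (card_le_card (monotone_filter_right _ fun e _ hje => ?_))
    have k1 := norm_sub_lt_of_angleClass hδ j e
    have k2 := norm_sub_lt_of_angleClass hδ j i
    rw [hje] at k1
    rw [hji] at k2
    have : z - e = (j - e) - (j - i) - (i - z) := by abel
    rw [this]
    refine (norm_sub_le _ _).trans ?_
    linarith [norm_sub_le (j - e) (j - i)]
  have h3 : Zp.card * N ≤ 4 * Λ * ((2 * N) * 7 ^ finrank ℝ E) := by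
    calc Zp.card * N = ∑ z ∈ Zp, N := by rw [sum_const, nsmul_eq_mul]
      _ ≤ ∑ z ∈ Zp, 4 * Λ *
          ((through A I p).filter fun e => ‖z - e‖ ≤ 3 * (2 ^ c * δ)).card := sum_le_sum h2
      _ = 4 * Λ * ∑ e ∈ through A I p,
          ((Zp.filter fun z => ‖z - e‖ ≤ 3 * (2 ^ c * δ)).card : ℝ) := by
        rw [← mul_sum, sum_card_filter_comm Zp (through A I p)
          fun z e => ‖z - e‖ ≤ 3 * (2 ^ c * δ)]
      _ ≤ 4 * Λ * ((through A I p).card * 7 ^ finrank ℝ E) := by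
        gcongr
        rw [← nsmul_eq_mul]
        refine sum_le_card_nsmul _ _ _ fun e _ => ?_
        have := (hZ.mono ((filter_subset (fun z => ‖z - e‖ ≤ 3 * (2 ^ c * δ)) Zp).trans
          (filter_subset _ _))).card_le hσ e (R := 3) (by norm_num) fun z hz => (mem_filter.1 hz).2
        norm_num at this
        exact this
      _ ≤ _ := by gcongr; exact hP p hp
  have h4 : Zp.card * N ≤ Λ ^ 2 * N := by
    refine h3.trans ?_
    calc 4 * Λ * ((2 * N) * 7 ^ finrank ℝ E) = (8 * 7 ^ finrank ℝ E) * (Λ * N) := by ring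
      _ ≤ Λ * (Λ * N) := by gcongr
      _ = _ := by ring
  exact le_of_mul_le_mul_right h4 hN

theorem mul_le_of_cell_bounds {δ Λ N W G T U M s : ℝ} {d : ℕ} (hd : 2 ≤ d) (hδ : 0 < δ)
    (hΛ0 : 0 < Λ) (hs0 : 0 < s) (hM : 0 ≤ M) (h5 : 5 ^ d * 2 ≤ Λ) (hσ1 : s * δ ≤ 1)
    (hdense : N * W ≤ 2 * Λ * G) (hdouble : G * (s * δ) ≤ Λ * T)
    (hcell : T * s ≤ (5 * s) ^ d * U) (hsum : U ≤ Λ ^ (8 * d + 17) * δ * (Λ ^ 2 * M)) :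
    N * W * δ ^ d ≤ Λ ^ (8 * d + 22) * δ ^ 2 * M := by
  have hmain : N * W * δ ^ d * (s ^ 2 * δ) ≤
      (Λ ^ (8 * d + 22) * δ ^ 2 * M) * (s ^ 2 * δ) := by
    calc N * W * δ ^ d * (s ^ 2 * δ) = δ ^ d * s * (N * W * (s * δ)) := by ring
      _ ≤ δ ^ d * s * (2 * Λ * G * (s * δ)) := by gcongr
      _ = δ ^ d * s * (2 * Λ * (G * (s * δ))) := by ring
      _ ≤ δ ^ d * s * (2 * Λ * (Λ * T)) := by gcongr
      _ = δ ^ d * (2 * Λ ^ 2) * (T * s) := by ring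
      _ ≤ δ ^ d * (2 * Λ ^ 2) * ((5 * s) ^ d * U) := by gcongr
      _ ≤ δ ^ d * (2 * Λ ^ 2) * ((5 * s) ^ d * (Λ ^ (8 * d + 17) * δ * (Λ ^ 2 * M))) := by
        gcongr
      _ = (5 ^ d * 2) * (Λ ^ (8 * d + 17 + 4) * (s * δ) ^ d * (δ * M)) := by
        rw [mul_pow, mul_pow, pow_add Λ _ 4]; ring
      _ ≤ Λ * (Λ ^ (8 * d + 17 + 4) * (s * δ) ^ 2 * (δ * M)) := by
        have := pow_le_pow_of_le_one (by positivity) hσ1 hd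
        gcongr
      _ = _ := by rw [pow_succ Λ (8 * d + 21)]; ring
  exact le_of_mul_le_mul_right hmain (by positivity)

omit [InnerProductSpace ℝ E] [FiniteDimensional ℝ E] in
theorem two_pow_mul_le_one_of_sum_coneCard_pos {A : E → Finset E} {I P : Finset E} {δ : ℝ}
    (hδ : 0 < δ) (hcap : ∀ v ∈ I, ∀ w ∈ I, ‖v - w‖ ≤ 1 / 2) {c : ℕ} (hc0 : c ≠ 0)
    (h : 0 < ∑ p ∈ P, ∑ e ∈ through A I p, coneCard δ A I c p e) : 2 ^ c * δ ≤ 1 := by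
  obtain ⟨p, -, hp⟩ := exists_ne_zero_of_sum_ne_zero h.ne'
  obtain ⟨e, he, hpe⟩ := exists_ne_zero_of_sum_ne_zero hp
  rw [coneCard, Nat.cast_ne_zero, card_ne_zero] at hpe
  obtain ⟨e', he'⟩ := hpe
  rw [mem_filter] at he'
  have h2 := le_norm_sub_of_angleClass hδ (by rw [he'.2]; exact hc0 : angleClass δ e e' ≠ 0)
  rw [he'.2] at h2
  linarith [hcap e (mem_filter.1 he).1 e' (mem_filter.1 he'.1).1]

/-- The bound on the multiplicity when most pairs of lines make an angle of class `c ≠ 0`. -/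
theorem multiplicity_le_of_angleClass_ne_zero {A : E → Finset E} {I P : Finset E} {δ Λ N : ℝ}
    (hδ : 0 < δ) (hd : 2 ≤ finrank ℝ E) (hΛ : 10000000 ^ finrank ℝ E ≤ Λ)
    {S : ℕ} (hSΛ : S + 2 ≤ Λ) (hS : 1 / δ ≤ 2 ^ S) (hΛδ : Λ ^ 20 * δ ≤ 1)
    (hIsep : Sep δ I) (hunit : ∀ v ∈ I, ‖v‖ = 1) (hcap : ∀ v ∈ I, ∀ w ∈ I, ‖v - w‖ ≤ 1 / 2)
    (hA : ∀ e ∈ I, Sep δ (A e)) (hline : ∀ e ∈ I, AlongLine δ e (A e))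
    (hdiam : ∀ e ∈ I, ∀ p ∈ A e, ∀ q ∈ A e, ‖p - q‖ ≤ 2) (hN : 0 < N)
    (hP : ∀ p ∈ P, ((through A I p).card : ℝ) ≤ 2 * N)
    (hW : 1 ≤ Λ ^ 4 * δ ^ finrank ℝ E * ∑ p ∈ P, ((through A I p).card : ℝ))
    (hI : I.card * δ ^ finrank ℝ E ≤ Λ * δ) {c : ℕ} (hc0 : c ≠ 0)
    (hc : N * ∑ p ∈ P, ((through A I p).card : ℝ) ≤
      Λ * ∑ p ∈ P, ∑ e ∈ through A I p, coneCard δ A I c p e) :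
    N * (∑ p ∈ P, ((through A I p).card : ℝ)) * δ ^ finrank ℝ E ≤
      Λ ^ (8 * finrank ℝ E + 22) * δ ^ 2 * P.card := by
  set d := finrank ℝ E with hd'
  have hΛ1 : (10000000 : ℝ) ≤ Λ := (le_self_pow₀ (by norm_num) (by omega)).trans hΛ
  have hΛ0 : 0 < Λ := by linarith
  have hδ1 : δ ≤ 1 := by
    refine le_trans ?_ hΛδ
    exact le_mul_of_one_le_left hδ.le (one_le_pow₀ (by linarith))
  have hconst : ∀ a b : ℝ, 1 ≤ a → 0 ≤ b → a * b ≤ 10000000 → b ^ d * a ≤ Λ := by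
    intro a b ha hb hab
    calc b ^ d * a ≤ b ^ d * a ^ d := by gcongr; exact le_self_pow₀ ha (by omega)
      _ = (a * b) ^ d := by rw [← mul_pow, mul_comm]
      _ ≤ 10000000 ^ d := by gcongr
      _ ≤ Λ := hΛ
  have h8 : 8 ≤ Λ := by linarith
  have hc360 := hconst 360 15 (by norm_num) (by norm_num) (by norm_num)
  have hc7 := hconst 8 7 (by norm_num) (by norm_num) (by norm_num)
  have hδd : 0 < δ ^ d := by positivity
  set W := ∑ p ∈ P, ((through A I p).card : ℝ) with hWdef
  have hWpos : 0 < W := lt_of_not_ge fun h => absurd hW (not_le.2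
    ((mul_nonpos_of_nonneg_of_nonpos (mul_pos (pow_pos hΛ0 4) hδd).le h).trans_lt one_pos))
  have hσ1 : 2 ^ c * δ ≤ 1 := two_pow_mul_le_one_of_sum_coneCard_pos hδ hcap hc0
    (lt_of_mul_lt_mul_left (by rw [mul_zero]; exact (mul_pos hN hWpos).trans_le hc) hΛ0.le)
  set A' : E → Finset E := fun e =>
    P.filter fun p => p ∈ A e ∧ N ≤ 4 * Λ * coneCard δ A I c p e with hA'
  have hA'A : ∀ e, A' e ⊆ A e := fun e p hp => (mem_filter.1 hp).2.1
  have hdense := sum_coneCard_dense A I P hδ hδd hN h8 c hP hW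
    hI hc A' fun e => rfl
  set J := I.filter fun e => 1 ≤ Λ ^ 7 * δ * (A' e).card with hJ
  have hdouble := sum_coneCard_mul_le (A := A) (A' := A') (I := I) (J := J) hδ hδ1
    hc360 (filter_subset _ _) hunit hcap hA
    hline hdiam hA'A c
  set H : E → Finset E := fun i =>
    J.filter fun j => angleClass δ j i = c ∧ (A' j ∩ A i).Nonempty with hH
  obtain ⟨Z, hZI, hZ, f, hf, hcell⟩ := exists_cell_representatives hδ
    (one_le_pow₀ (by norm_num) : (1 : ℝ) ≤ 2 ^ c) hIsep hunit (h := fun i => ((H i).card : ℝ))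
    fun i => Nat.cast_nonneg _
  have hbrush : ∀ z ∈ Z, ((H (f z)).card : ℝ) ≤
      Λ ^ (8 * d + 17) * δ * ((H (f z)).biUnion A').card := by
    intro z hz
    have hHI : H (f z) ⊆ I := (filter_subset _ _).trans (filter_subset _ _)
    refine card_hairbrush_le_of_dense hδ hd hΛ hSΛ hS hΛδ (hline _ (hf z hz).1)
      (hIsep.mono hHI) (fun w hw => hunit w (hHI hw))
      (fun v hv w hw => hcap v (hHI hv) w (hHI hw)) (fun j hj => (hA j (hHI hj)).mono (hA'A j))
      (fun j hj => (hline j (hHI hj)).subset (hA'A j))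
      (fun j hj p hp q hq => hdiam j (hHI hj) p (hA'A j hp) q (hA'A j hq))
      (fun j hj => (mem_filter.1 hj).2.2) fun j hj => (mem_filter.1 (mem_filter.1 hj).1).2
  have hover := sum_card_biUnion_le (A := A) (A' := A') (I := I) (H := fun z => H (f z)) hδ hN
    ((mul_comm _ _).trans_le hc7) hP
    (fun e => filter_subset _ _) (fun e p hp => (mem_filter.1 hp).2.2) hZ
    (fun z hz j hj => ⟨f z, (mem_filter.1 hj).2.1, (hf z hz).2⟩)
  have hsum : ∑ z ∈ Z, ((H (f z)).card : ℝ) ≤ Λ ^ (8 * d + 17) * δ * (Λ ^ 2 * P.card) := by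
    refine (sum_le_sum hbrush).trans ?_
    rw [← mul_sum]
    gcongr
  exact mul_le_of_cell_bounds hd hδ hΛ0 (by positivity) (Nat.cast_nonneg _)
    (hconst 2 5 (by norm_num) (by norm_num) (by norm_num)) hσ1 hdense hdouble hcell hsum

omit [InnerProductSpace ℝ E] [FiniteDimensional ℝ E] in
theorem multiplicity_le_of_angleClass_eq_zero {A : E → Finset E} {I P : Finset E} {δ Λ N : ℝ}
    (hδ : 0 < δ) (hΛ0 : 0 < Λ) (hIsep : Sep δ I)
    (hWpos : 0 < ∑ p ∈ P, ((through A I p).card : ℝ))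
    (hc : N * ∑ p ∈ P, ((through A I p).card : ℝ) ≤
      Λ * ∑ p ∈ P, ∑ e ∈ through A I p, coneCard δ A I 0 p e) : N ≤ Λ := by
  have h1 : ∀ p ∈ P, ∑ e ∈ through A I p, coneCard δ A I 0 p e ≤ (through A I p).card := by
    intro p _
    refine (sum_le_card_nsmul _ _ 1 fun e he => ?_).trans (by simp)
    unfold coneCard
    rw [Nat.cast_le_one, card_le_one]
    have key : ∀ a ∈ (through A I p).filter fun e' => angleClass δ e e' = 0, e = a := by
      intro a ha
      rw [mem_filter] at ha
      by_contra hne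
      have h2 := hIsep e (mem_filter.1 he).1 a (mem_filter.1 ha.1).1 hne
      have h3 := norm_sub_lt_of_angleClass hδ e a
      rw [ha.2, pow_zero, one_mul] at h3
      linarith
    intro a ha b hb
    rw [← key a ha, ← key b hb]
  refine le_of_mul_le_mul_right (hc.trans ?_) hWpos
  gcongr with p hp
  exact h1 p hp

omit [DecidableEq E] in
theorem Sep.card_mul_pow_le_of_unit {I : Finset E} {δ : ℝ} (hδ : 0 < δ) (hδ1 : δ ≤ 1)
    (hI : Sep δ I) (hunit : ∀ v ∈ I, ‖v‖ = 1) :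
    I.card * δ ^ finrank ℝ E ≤ 5 ^ finrank ℝ E * δ := by
  have h := hI.card_le_of_unit hδ hunit 0 (R := 1 / δ) (by rw [le_div_iff₀ hδ]; linarith)
    fun p hp => by rw [sub_zero, hunit p hp, div_mul_cancel₀ _ hδ.ne']
  rw [mul_one_div, mul_one_div, div_pow, div_le_div_iff₀ hδ (by positivity)] at h
  exact h

theorem one_le_of_multiplicity {Λ D N W M : ℝ} (hΛ0 : 0 < Λ) (hD : 0 < D)
    (hW : 1 ≤ Λ ^ 4 * D * W) (hWM : W ≤ 2 * N * M) :
    1 ≤ Λ ^ 8 * D * (N * W * D) * (2 * M) := by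
  have hW0 : 0 < W := by
    by_contra! h
    have : Λ ^ 4 * D * W ≤ 0 := mul_nonpos_of_nonneg_of_nonpos (by positivity) h
    linarith
  calc 1 ≤ (Λ ^ 4 * D * W) * (Λ ^ 4 * D * W) := one_le_mul_of_one_le_of_one_le hW hW
    _ ≤ (Λ ^ 4 * D * W) * (Λ ^ 4 * D * (2 * N * M)) := by gcongr
    _ = _ := by ring

/-- The discrete form of Wolff's bound: a `δ`-separated set containing many points on a line in
each of `≳ δ ^ (1 - d)` many `δ`-separated directions has `≳ δ ^ (- (d + 2) / 2)` points. -/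
theorem one_le_mul_card_sq {A : E → Finset E} {I P : Finset E} {δ Λ : ℝ}
    (hδ : 0 < δ) (hd : 2 ≤ finrank ℝ E) (hΛ : 10000000 ^ finrank ℝ E ≤ Λ)
    {S : ℕ} (hSΛ : S + 2 ≤ Λ) (hS : 1 / δ ≤ 2 ^ S) (hΛδ : Λ ^ 20 * δ ≤ 1)
    (hPsep : Sep δ P) (hIsep : Sep δ I) (hunit : ∀ v ∈ I, ‖v‖ = 1)
    (hcap : ∀ v ∈ I, ∀ w ∈ I, ‖v - w‖ ≤ 1 / 2) (hAP : ∀ e ∈ I, A e ⊆ P)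
    (hline : ∀ e ∈ I, AlongLine δ e (A e))
    (hdiam : ∀ e ∈ I, ∀ p ∈ A e, ∀ q ∈ A e, ‖p - q‖ ≤ 2)
    (hdense : ∀ e ∈ I, 1 ≤ Λ * δ * (A e).card) (hI : δ ≤ Λ * I.card * δ ^ finrank ℝ E) :
    1 ≤ Λ ^ (8 * finrank ℝ E + 31) * δ ^ (finrank ℝ E + 2) * (P.card : ℝ) ^ 2 := by
  set d := finrank ℝ E with hd'
  have hΛ1 : (10000000 : ℝ) ≤ Λ := (le_self_pow₀ (by norm_num) (by omega)).trans hΛ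
  have hΛ0 : 0 < Λ := by linarith
  have hδ1 : δ ≤ 1 :=
    (le_mul_of_one_le_left hδ.le (one_le_pow₀ (by linarith))).trans hΛδ
  have hIle := hIsep.card_mul_pow_le_of_unit hδ hδ1 hunit
  rw [← hd'] at hIle
  have hIle' : I.card * δ ^ d ≤ Λ * δ := hIle.trans (by
    gcongr
    refine le_trans ?_ hΛ
    gcongr
    norm_num)
  have hK : I.card < 2 ^ ((S + 3) * d) := by
    have h1 : (I.card : ℝ) ≤ (5 * 2 ^ S) ^ d := by
      calc (I.card : ℝ) = (I.card * δ ^ d) * (1 / δ) ^ d := by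
            rw [one_div, inv_pow]; field_simp
        _ ≤ (5 ^ d * 1) * (2 ^ S) ^ d := by
            have := hIle.trans (mul_le_mul_of_nonneg_left hδ1 (by positivity))
            gcongr
        _ = _ := by rw [mul_one, mul_pow]
    have h2 : ((5 : ℝ) * 2 ^ S) ^ d < (2 ^ (S + 3)) ^ d := by
      have h0 : (5 : ℝ) * 2 ^ S < 2 ^ (S + 3) := by
        rw [pow_add, mul_comm]
        gcongr
        norm_num
      exact pow_lt_pow_left₀ h0 (by positivity) (by omega)
    rw [← pow_mul] at h2
    exact_mod_cast h1.trans_lt h2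
  have hKΛ : (((S + 3) * d : ℕ) : ℝ) + 1 ≤ Λ ^ 2 := by
    have h1 : (2 * d + 1 : ℝ) ≤ Λ := by
      refine le_trans ?_ hΛ
      have h2 : d + 1 ≤ 2 ^ d := Nat.lt_two_pow_self
      have h3 : (d : ℝ) + 1 ≤ 2 ^ d := by exact_mod_cast h2
      have h4 : (2 : ℝ) ^ d * 2 ^ d = 4 ^ d := by rw [← mul_pow]; norm_num
      have h5 : (4 : ℝ) ^ d ≤ 10000000 ^ d := by gcongr; norm_num
      have h6 : (2 : ℝ) ≤ 2 ^ d := le_self_pow₀ (by norm_num) (by omega)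
      have h7 : (2 : ℝ) * 2 ^ d ≤ 2 ^ d * 2 ^ d := by gcongr
      linarith
    push_cast
    have h8 : ((S : ℝ) + 3) ≤ 2 * Λ := by linarith
    calc ((S : ℝ) + 3) * d + 1 ≤ 2 * Λ * d + Λ := by gcongr; linarith
      _ = Λ * (2 * d + 1) := by ring
      _ ≤ Λ * Λ := by gcongr
      _ = _ := by ring
  have hinc : 1 ≤ Λ ^ 2 * δ ^ d * ∑ e ∈ I, ((A e).card : ℝ) := by
    have h1 : (I.card : ℝ) ≤ Λ * δ * ∑ e ∈ I, ((A e).card : ℝ) := by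
      rw [mul_sum]
      simpa using card_nsmul_le_sum I _ 1 hdense
    have h2 : δ * 1 ≤ δ * (Λ ^ 2 * δ ^ d * ∑ e ∈ I, ((A e).card : ℝ)) := by
      calc δ * 1 ≤ Λ * I.card * δ ^ d := by rw [mul_one]; exact hI
        _ ≤ Λ * (Λ * δ * ∑ e ∈ I, ((A e).card : ℝ)) * δ ^ d := by gcongr
        _ = _ := by ring
    exact le_of_mul_le_mul_left h2 hδ
  have hincpos : 0 < ∑ e ∈ I, ((A e).card : ℝ) := by
    refine lt_of_not_ge fun h => absurd hinc (not_le.2 (lt_of_le_of_lt ?_ one_pos))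
    exact mul_nonpos_of_nonneg_of_nonpos (by positivity) h
  obtain ⟨N, hN, P', hP'P, hP', hlevel⟩ := exists_multiplicity_level A I P hAP hK hincpos
  obtain ⟨c, hc⟩ := exists_angleClass A I P' hδ hS hcap fun p hp => (hP' p hp).1
  have hcΛ : N * ∑ p ∈ P', ((through A I p).card : ℝ) ≤
      Λ * ∑ p ∈ P', ∑ e ∈ through A I p, coneCard δ A I c p e := by
    refine hc.trans (mul_le_mul_of_nonneg_right (by linarith) ?_)
    exact sum_nonneg fun p _ => sum_nonneg fun e _ => Nat.cast_nonneg _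
  have hW : 1 ≤ Λ ^ 4 * δ ^ d * ∑ p ∈ P', ((through A I p).card : ℝ) := by
    refine hinc.trans ?_
    calc Λ ^ 2 * δ ^ d * ∑ e ∈ I, ((A e).card : ℝ)
        ≤ Λ ^ 2 * δ ^ d * (Λ ^ 2 * ∑ p ∈ P', ((through A I p).card : ℝ)) := by
          refine mul_le_mul_of_nonneg_left (hlevel.trans ?_) (by positivity)
          exact mul_le_mul_of_nonneg_right hKΛ (sum_nonneg fun p _ => Nat.cast_nonneg _)
      _ = _ := by ring
  have hPP' : (P'.card : ℝ) ≤ P.card := by exact_mod_cast card_le_card hP'P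
  have hWM : ∑ p ∈ P', ((through A I p).card : ℝ) ≤ 2 * N * P.card := by
    refine (sum_le_card_nsmul _ _ _ fun p hp => (hP' p hp).2).trans ?_
    rw [nsmul_eq_mul, mul_comm]
    gcongr
  have hone := one_le_of_multiplicity hΛ0 (by positivity : 0 < δ ^ d) hW hWM
  have hWpos : 0 < ∑ p ∈ P', ((through A I p).card : ℝ) :=
    pos_of_mul_pos_right (hincpos.trans_le hlevel) (by positivity)
  by_cases hc0 : c = 0
  · subst hc0
    have hNΛ := multiplicity_le_of_angleClass_eq_zero hδ hΛ0 hIsep hWpos hcΛ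
    set W := ∑ p ∈ P', ((through A I p).card : ℝ)
    clear_value W
    calc (1 : ℝ) ≤ Λ ^ 8 * δ ^ d * (N * W * δ ^ d) * (2 * P.card) := hone
      _ ≤ Λ ^ 8 * δ ^ d * (Λ * (2 * Λ * P.card) * δ ^ d) * (2 * P.card) := by
        gcongr
        exact hWM.trans (by gcongr)
      _ = 4 * (Λ ^ 10 * δ ^ (d + d) * (P.card : ℝ) ^ 2) := by rw [pow_add]; ring
      _ ≤ Λ * (Λ ^ (8 * d + 30) * δ ^ (d + 2) * (P.card : ℝ) ^ 2) := by
        gcongr ?_ * (?_ * ?_ * _)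
        · linarith
        · exact pow_le_pow_right₀ (by linarith) (by omega)
        · exact pow_le_pow_of_le_one hδ.le hδ1 (by omega)
      _ = _ := by rw [pow_succ Λ (8 * d + 30)]; ring
  · have h := multiplicity_le_of_angleClass_ne_zero hδ hd hΛ hSΛ hS hΛδ hIsep hunit hcap
      (fun e he => hPsep.mono (hAP e he)) hline hdiam hN (fun p hp => (hP' p hp).2) hW hIle' hc0 hcΛ
    rw [← hd'] at h
    set W := ∑ p ∈ P', ((through A I p).card : ℝ)
    clear_value W
    calc (1 : ℝ) ≤ Λ ^ 8 * δ ^ d * (N * W * δ ^ d) * (2 * P.card) := hone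
      _ ≤ Λ ^ 8 * δ ^ d * (Λ ^ (8 * d + 22) * δ ^ 2 * P.card) * (2 * P.card) := by
        have := h.trans (mul_le_mul_of_nonneg_left hPP' (by positivity))
        gcongr
      _ = 2 * (Λ ^ (8 * d + 30) * δ ^ (d + 2) * (P.card : ℝ) ^ 2) := by
        rw [pow_add δ, pow_add Λ, pow_add Λ]; ring
      _ ≤ Λ * (Λ ^ (8 * d + 30) * δ ^ (d + 2) * (P.card : ℝ) ^ 2) := by
        gcongr; linarith
      _ = _ := by rw [pow_succ Λ (8 * d + 30)]; ring

end Incidence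

section Reduction

variable {E : Type*} [NormedAddCommGroup E] [InnerProductSpace ℝ E] [FiniteDimensional ℝ E]

/-- A set of unit vectors contains a finite maximal `δ`-separated subset. -/
theorem exists_sep_subset_of_unit {Ω : Set E} (hΩ : ∀ e ∈ Ω, ‖e‖ = 1) {δ : ℝ} (hδ : 0 < δ) :
    ∃ I : Finset E, (∀ e ∈ I, e ∈ Ω) ∧ Sep δ I ∧ ∀ e ∈ Ω, ∃ i ∈ I, ‖e - i‖ < δ := by
  classical
  set T : Set ℕ := {k | ∃ I : Finset E, (∀ e ∈ I, e ∈ Ω) ∧ Sep δ I ∧ I.card = k} with hT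
  have hne : T.Nonempty := ⟨0, ∅, by simp, by simp [Sep], rfl⟩
  have hbdd : BddAbove T := by
    refine ⟨⌊(2 * (1 / δ) + 1) ^ finrank ℝ E⌋₊, ?_⟩
    rintro k ⟨I, hIΩ, hI, rfl⟩
    refine Nat.le_floor (hI.card_le hδ 0 (by positivity) fun p hp => ?_)
    rw [sub_zero, hΩ p (hIΩ p hp), div_mul_cancel₀ _ hδ.ne']
  obtain ⟨I, hIΩ, hI, hcard⟩ := Nat.sSup_mem hne hbdd
  refine ⟨I, hIΩ, hI, fun e he => ?_⟩
  by_contra! h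
  have heI : e ∉ I := fun heI => by
    have := h e heI
    rw [sub_self, norm_zero] at this
    linarith
  have hmem : (insert e I).card ∈ T := by
    refine ⟨insert e I, fun x hx => ?_, ?_, rfl⟩
    · rcases mem_insert.1 hx with rfl | hx'
      exacts [he, hIΩ x hx']
    · intro p hp q hq hpq
      rcases mem_insert.1 hp with rfl | hp' <;> rcases mem_insert.1 hq with rfl | hq'
      · exact absurd rfl hpq
      · exact h q hq'
      · rw [norm_sub_rev]; exact h p hp'
      · exact hI p hp' q hq' hpq
  have := le_csSup hbdd hmem
  rw [card_insert_of_notMem heI, hcard] at this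
  omega

omit [FiniteDimensional ℝ E] in
theorem volume_near_point_le {e : E} (he : ‖e‖ = 1) (x p : E) (r : ℝ) :
    volume {t : ℝ | ‖x + t • e - p‖ ≤ r} ≤ ENNReal.ofReal (2 * r) := by
  have h : {t : ℝ | ‖x + t • e - p‖ ≤ r} ⊆ Metric.closedBall (inner ℝ e (p - x)) r := by
    intro t ht
    rw [Metric.mem_closedBall, Real.dist_eq]
    have h1 : t - inner ℝ e (p - x) = inner ℝ e (x + t • e - p) := by
      rw [show x + t • e - p = t • e - (p - x) by abel, inner_sub_right e (t • e), inner_smul_right,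
        real_inner_self_eq_norm_sq, he]
      ring
    rw [h1]
    refine (abs_real_inner_le_norm _ _).trans ?_
    rw [he, one_mul]
    exact ht
  refine (measure_mono h).trans ?_
  rw [Real.volume_closedBall]

/-- If each of many separated unit segments has a large part covered by the `δ`-balls around a
finite set, then this set is large. -/
theorem one_le_mul_card_sq_of_cover {I F : Finset E} {δ Λ w : ℝ} (hδ : 0 < δ)
    (hd : 2 ≤ finrank ℝ E) (hΛ : 10000000 ^ finrank ℝ E ≤ Λ) {S : ℕ} (hSΛ : S + 2 ≤ Λ)
    (hS : 1 / δ ≤ 2 ^ S) (hΛδ : Λ ^ 20 * δ ≤ 1) (hIsep : Sep δ I) (hunit : ∀ v ∈ I, ‖v‖ = 1)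
    (hcap : ∀ v ∈ I, ∀ w ∈ I, ‖v - w‖ ≤ 1 / 2) (x : E → E) (hw : 4 ≤ Λ * w)
    (hcov : ∀ e ∈ I, ENNReal.ofReal w ≤
      volume {t : ℝ | t ∈ Set.Icc (0 : ℝ) 1 ∧ ∃ p ∈ F, ‖x e + t • e - p‖ ≤ δ})
    (hI : δ ≤ Λ * I.card * δ ^ finrank ℝ E) :
    1 ≤ Λ ^ (8 * finrank ℝ E + 31) * δ ^ (finrank ℝ E + 2) * (F.card : ℝ) ^ 2 := by
  classical
  have hΛ1 : (10000000 : ℝ) ≤ Λ := (le_self_pow₀ (by norm_num) (by omega)).trans hΛ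
  have hΛ0 : 0 < Λ := by linarith
  have hδ4 : 4 * δ ≤ 1 := by
    refine le_trans ?_ hΛδ
    gcongr
    exact (by linarith : (4 : ℝ) ≤ Λ).trans (le_self_pow₀ (by linarith) (by norm_num))
  obtain ⟨P, hPF, hP, hPcov⟩ := exists_sep_subset F hδ
  set A : E → Finset E := fun e =>
    P.filter fun p => ∃ t ∈ Set.Icc (0 : ℝ) 1, ‖x e + t • e - p‖ ≤ 2 * δ with hA
  have hpar : ∀ e, ∃ t : E → ℝ, ∀ p ∈ A e, t p ∈ Set.Icc (0 : ℝ) 1 ∧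
      ‖x e + t p • e - p‖ ≤ 2 * δ := by
    intro e
    have : ∀ p ∈ A e, ∃ t : ℝ, t ∈ Set.Icc (0 : ℝ) 1 ∧ ‖x e + t • e - p‖ ≤ 2 * δ :=
      fun p hp => (mem_filter.1 hp).2
    choose! t ht using this
    exact ⟨t, ht⟩
  choose t ht using hpar
  have hclose : ∀ e, ∀ p ∈ A e, ∀ q ∈ A e, ‖p - q - (t e p - t e q) • e‖ ≤ 4 * δ := by
    intro e p hp q hq
    have : p - q - (t e p - t e q) • e = (x e + t e q • e - q) - (x e + t e p • e - p) := by
      rw [sub_smul]; abel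
    rw [this]
    refine (norm_sub_le _ _).trans ?_
    linarith [(ht e p hp).2, (ht e q hq).2]
  have hdense : ∀ e ∈ I, 1 ≤ Λ * δ * (A e).card := by
    intro e he
    have h1 : {t : ℝ | t ∈ Set.Icc (0 : ℝ) 1 ∧ ∃ p ∈ F, ‖x e + t • e - p‖ ≤ δ} ⊆
        ⋃ p ∈ A e, {t : ℝ | ‖x e + t • e - p‖ ≤ 2 * δ} := by
      rintro s ⟨hs, p, hp, hsp⟩
      obtain ⟨q, hq, hpq⟩ := hPcov p hp
      have : ‖x e + s • e - q‖ ≤ 2 * δ := by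
        rw [← sub_add_sub_cancel _ p q]
        refine (norm_add_le _ _).trans ?_
        linarith
      rw [Set.mem_iUnion₂]
      exact ⟨q, mem_filter.2 ⟨hq, s, hs, this⟩, this⟩
    have h2 := calc ENNReal.ofReal w ≤ _ := hcov e he
      _ ≤ _ := measure_mono h1
      _ ≤ ∑ p ∈ A e, volume {t : ℝ | ‖x e + t • e - p‖ ≤ 2 * δ} := measure_biUnion_finset_le _ _
      _ ≤ ∑ p ∈ A e, ENNReal.ofReal (2 * (2 * δ)) :=
        sum_le_sum fun p _ => volume_near_point_le (hunit e he) _ _ _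
      _ = ENNReal.ofReal ((A e).card * (2 * (2 * δ))) := by
        rw [sum_const, nsmul_eq_mul, ENNReal.ofReal_mul (Nat.cast_nonneg _),
          ENNReal.ofReal_natCast]
    rw [ENNReal.ofReal_le_ofReal_iff (by positivity)] at h2
    have h3 : Λ * w ≤ Λ * ((A e).card * (2 * (2 * δ))) := by gcongr
    linarith
  refine (one_le_mul_card_sq (A := A) (P := P) hδ hd hΛ hSΛ hS hΛδ hP hIsep hunit hcap
    (fun e _ => filter_subset _ _) (fun e _ => ⟨t e, hclose e⟩) (fun e he p hp q hq => ?_) hdense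
    hI).trans ?_
  · have h1 := hclose e p hp q hq
    have h2 := norm_add_le (p - q - (t e p - t e q) • e) ((t e p - t e q) • e)
    rw [sub_add_cancel, norm_smul, hunit e he, mul_one, Real.norm_eq_abs] at h2
    have h3 : |t e p - t e q| ≤ 1 := by
      have := (ht e p hp).1
      have := (ht e q hq).1
      rw [abs_le]
      constructor <;> linarith [this.1, this.2, (ht e p hp).1.1, (ht e p hp).1.2]
    linarith
  · gcongr

/-- A truncated cone over a set of directions is covered by balls along finitely many rays. -/
theorem measure_cone_le [MeasurableSpace E] [BorelSpace E] (μ : Measure E) [μ.IsAddHaarMeasure]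
    {Ω : Set E} {I : Finset E} {m : ℕ}
    (hI : ∀ e ∈ Ω, ∃ i ∈ I, ‖e - i‖ < (1 / 2) ^ m) (hunit : ∀ i ∈ I, ‖i‖ = 1) :
    μ {y | ∃ ρ ∈ Set.Icc (1 : ℝ) 2, ∃ e ∈ Ω, y = ρ • e} ≤
      ENNReal.ofReal (I.card * ((2 ^ m + 1) * (3 * (1 / 2) ^ m) ^ finrank ℝ E)) *
        μ (Metric.ball 0 1) := by
  set δ : ℝ := (1 / 2) ^ m with hδ'
  have hδ : 0 < δ := by positivity
  have hm : (2 : ℝ) ^ m * δ = 1 := by rw [hδ', ← mul_pow]; norm_num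
  have hsub : {y | ∃ ρ ∈ Set.Icc (1 : ℝ) 2, ∃ e ∈ Ω, y = ρ • e} ⊆
      ⋃ i ∈ I, ⋃ a ∈ range (2 ^ m + 1), Metric.closedBall ((1 + a * δ) • i) (3 * δ) := by
    rintro y ⟨ρ, ⟨hρ1, hρ2⟩, e, he, rfl⟩
    obtain ⟨i, hi, hei⟩ := hI e he
    simp only [Set.mem_iUnion]
    have h0 : 0 ≤ (ρ - 1) / δ := div_nonneg (by linarith) hδ.le
    refine ⟨i, hi, ⌊(ρ - 1) / δ⌋₊, ?_, ?_⟩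
    · rw [mem_range, Nat.lt_succ_iff]
      refine Nat.floor_le_of_le ?_
      rw [div_le_iff₀ hδ]
      push_cast
      rw [hm]
      linarith
    · have h1 := Nat.floor_le h0
      have h2 := Nat.lt_floor_add_one ((ρ - 1) / δ)
      rw [le_div_iff₀ hδ] at h1
      rw [div_lt_iff₀ hδ] at h2
      set a : ℝ := (⌊(ρ - 1) / δ⌋₊ : ℝ)
      rw [Metric.mem_closedBall, dist_eq_norm,
        show ρ • e - (1 + a * δ) • i = ρ • (e - i) + (ρ - 1 - a * δ) • i by
          rw [smul_sub, sub_smul, sub_smul, add_smul]; abel]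
      refine (norm_add_le _ _).trans ?_
      rw [norm_smul, norm_smul, hunit i hi, mul_one, Real.norm_eq_abs, Real.norm_eq_abs,
        abs_of_nonneg (by linarith : 0 ≤ ρ), abs_of_nonneg (by linarith : 0 ≤ ρ - 1 - a * δ)]
      have : ρ * ‖e - i‖ ≤ 2 * δ := by gcongr
      linarith
  calc _ ≤ _ := measure_mono hsub
    _ ≤ ∑ i ∈ I, μ (⋃ a ∈ range (2 ^ m + 1), Metric.closedBall ((1 + a * δ) • i) (3 * δ)) :=
      measure_biUnion_finset_le _ _
    _ ≤ ∑ i ∈ I, ∑ a ∈ range (2 ^ m + 1), μ (Metric.closedBall ((1 + a * δ) • i) (3 * δ)) :=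
      sum_le_sum fun i _ => measure_biUnion_finset_le _ _
    _ = _ := by
      simp only [Measure.addHaar_closedBall μ _ (by positivity : 0 ≤ 3 * δ), sum_const,
        card_range, nsmul_eq_mul]
      rw [ENNReal.ofReal_mul (Nat.cast_nonneg _), ENNReal.ofReal_mul (by positivity),
        ENNReal.ofReal_natCast, mul_assoc, mul_assoc,
        show ((2 : ℝ) ^ m + 1) = ((2 ^ m + 1 : ℕ) : ℝ) by push_cast; rfl, ENNReal.ofReal_natCast]

theorem exists_dyadic_scale {a s D ε : ℝ} (hs : 0 < s) (ha : a = (1 / 2) ^ s) {k₀ : ℕ}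
    (hD : 0 ≤ D) (hDk : D ≤ (1 / 2) ^ k₀) (hε : 0 < ε) :
    ∃ k, k₀ ≤ k ∧ D ≤ (1 / 2) ^ k ∧ a ^ k ≤ D ^ s / a + ε := by
  have ha0 : 0 < a := by rw [ha]; positivity
  have ha1 : a < 1 := by rw [ha]; exact Real.rpow_lt_one (by norm_num) (by norm_num) hs
  rcases hD.eq_or_lt with rfl | hD0
  · obtain ⟨n, hn⟩ := exists_pow_lt_of_lt_one hε ha1
    refine ⟨max k₀ n, le_max_left _ _, by positivity, ?_⟩
    rw [Real.zero_rpow hs.ne', zero_div, zero_add]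
    exact (pow_le_pow_of_le_one ha0.le ha1.le (le_max_right _ _)).trans hn.le
  · obtain ⟨n, hn, hn'⟩ := exists_nat_pow_near_of_lt_one hD0
      (hDk.trans (pow_le_one₀ (by norm_num) (by norm_num))) (by norm_num : (0 : ℝ) < 1 / 2)
      (by norm_num)
    refine ⟨n, ?_, hn', ?_⟩
    · have := (pow_lt_pow_iff_right_of_lt_one₀ (by norm_num : (0 : ℝ) < 1 / 2) (by norm_num)).1
        (hn.trans_le hDk)
      omega
    · have h : a ^ (n + 1) ≤ D ^ s := by
        rw [ha, ← Real.rpow_natCast, ← Real.rpow_mul (by norm_num), mul_comm s,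
          Real.rpow_mul (by norm_num), Real.rpow_natCast]
        exact Real.rpow_le_rpow (by positivity) hn.le hs.le
      have : a ^ n ≤ D ^ s / a := by
        rw [le_div_iff₀ ha0, ← pow_succ]; exact h
      linarith

/-- A set of vanishing `s`-dimensional Hausdorff measure is covered by boundedly many
`2 ^ (-m)`-balls, up to a factor `2 ^ (m * s)`, at small dyadic scales. -/
theorem exists_dyadic_cover {X : Type*} [NormedAddCommGroup X] [MeasurableSpace X] [BorelSpace X]
    {K : Set X} {a s : ℝ} (hs : 0 < s) (ha : a = (1 / 2) ^ s) (hK : μH[s] K = 0) (k₀ : ℕ) :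
    ∃ F : ℕ → Finset X, (∀ m, ((F m).card : ℝ) * a ^ m ≤ 1 / a + 2) ∧
      ∀ x ∈ K, ∃ m, k₀ ≤ m ∧ ∃ p ∈ F m, ‖x - p‖ ≤ (1 / 2) ^ m := by
  classical
  have ha0 : 0 < a := by rw [ha]; positivity
  rw [Measure.hausdorffMeasure_apply] at hK
  have hr : (0 : ENNReal) < ENNReal.ofReal ((1 / 2) ^ k₀) := ENNReal.ofReal_pos.2 (by positivity)
  have h1 := (le_iSup₂ (f := fun (r : ENNReal) (_ : 0 < r) =>
    ⨅ (t : ℕ → Set X) (_ : K ⊆ ⋃ n, t n) (_ : ∀ n, Metric.ediam (t n) ≤ r),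
      ∑' n, ⨆ _ : (t n).Nonempty, Metric.ediam (t n) ^ s) _ hr).trans hK.le
  have h2 := lt_of_le_of_lt h1 one_pos
  simp only [iInf_lt_iff] at h2
  obtain ⟨t, hKt, hdiam, hsum⟩ := h2
  set D : ℕ → ℝ := fun j => (Metric.ediam (t j)).toReal with hD
  have hfin : ∀ j, Metric.ediam (t j) ≠ ⊤ := fun j =>
    ((hdiam j).trans_lt ENNReal.ofReal_lt_top).ne
  have hDk : ∀ j, D j ≤ (1 / 2) ^ k₀ := fun j =>
    ENNReal.toReal_le_of_le_ofReal (by positivity) (hdiam j)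
  have hk := fun j => exists_dyadic_scale hs ha ENNReal.toReal_nonneg (hDk j)
    (by positivity : (0 : ℝ) < (1 / 2) ^ j)
  choose k hk₀ hDle hka using hk
  set J : ℕ → Set ℕ := fun m => {j | (t j).Nonempty ∧ k j = m} with hJ
  have hcard : ∀ m, ∀ G : Finset ℕ, (G : Set ℕ) ⊆ J m → (G.card : ℝ) * a ^ m ≤ 1 / a + 2 := by
    intro m G hG
    have hDs : ∑ j ∈ G, D j ^ s ≤ 1 := by
      have h3 : ∑ j ∈ G, ENNReal.ofReal (D j ^ s) ≤ 1 := by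
        refine le_trans ?_ ((ENNReal.sum_le_tsum G).trans hsum.le)
        refine sum_le_sum fun j hj => ?_
        rw [ciSup_pos (hG hj).1, hD, ENNReal.toReal_rpow, ENNReal.ofReal_toReal]
        exact ENNReal.rpow_ne_top_of_nonneg hs.le (hfin j)
      rw [← ENNReal.ofReal_sum_of_nonneg fun j _ => Real.rpow_nonneg ENNReal.toReal_nonneg _] at h3
      exact ENNReal.ofReal_le_one.1 h3
    have hgeo : ∑ j ∈ G, (1 / 2 : ℝ) ^ j ≤ 2 :=
      (summable_geometric_two.sum_le_tsum G fun _ _ => by positivity).trans tsum_geometric_two.le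
    calc (G.card : ℝ) * a ^ m = ∑ j ∈ G, a ^ m := by rw [sum_const, nsmul_eq_mul]
      _ ≤ ∑ j ∈ G, (D j ^ s / a + (1 / 2) ^ j) := sum_le_sum fun j hj => by
        rw [← (hG hj).2]; exact hka j
      _ = (∑ j ∈ G, D j ^ s) / a + ∑ j ∈ G, (1 / 2 : ℝ) ^ j := by rw [sum_add_distrib, sum_div]
      _ ≤ _ := by gcongr
  have hJfin : ∀ m, (J m).Finite := by
    intro m
    by_contra hinf
    obtain ⟨N, hN⟩ := exists_nat_gt ((1 / a + 2) / a ^ m)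
    obtain ⟨G, hG, rfl⟩ := Set.Infinite.exists_subset_card_eq hinf N
    rw [div_lt_iff₀ (by positivity)] at hN
    exact absurd (hcard m G hG) (not_le.2 hN)
  set c : ℕ → X := fun j => if h : (t j).Nonempty then h.some else 0 with hc
  refine ⟨fun m => (hJfin m).toFinset.image c, fun m => ?_, fun x hx => ?_⟩
  · refine le_trans ?_ (hcard m (hJfin m).toFinset (by simp))
    gcongr
    exact card_image_le
  · obtain ⟨j, hj⟩ := Set.mem_iUnion.1 (hKt hx)
    have hne : (t j).Nonempty := ⟨x, hj⟩
    refine ⟨k j, hk₀ j, c j, mem_image_of_mem c ((hJfin _).mem_toFinset.2 ⟨hne, rfl⟩), ?_⟩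
    refine le_trans ?_ (hDle j)
    have hcj : c j ∈ t j := by rw [hc]; simp only [dif_pos hne]; exact hne.some_mem
    rw [← dist_eq_norm, dist_edist]
    exact ENNReal.toReal_mono (hfin j) (Metric.edist_le_ediam_of_mem hj hcj)

theorem eventually_scale_bounds {n B : ℕ} {a C : ℝ} (ha0 : 0 < a) (ha : (1 / 2) ^ (n + 2) < a ^ 2) :
    ∀ᶠ m : ℕ in Filter.atTop, (10000000 : ℝ) ^ n ≤ 4 * (m : ℝ) ^ 2 ∧
      (m : ℝ) + 2 ≤ 4 * (m : ℝ) ^ 2 ∧ (4 * (m : ℝ) ^ 2) ^ 20 * (1 / 2) ^ m ≤ 1 ∧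
      (4 * (m : ℝ) ^ 2) ^ B * ((1 / 2) ^ m) ^ (n + 2) * (C / a ^ m) ^ 2 < 1 := by
  have hcast : Filter.Tendsto (fun m : ℕ => (m : ℝ)) Filter.atTop Filter.atTop :=
    tendsto_natCast_atTop_atTop
  have key : ∀ (k : ℕ) (c r : ℝ), 0 ≤ r → r < 1 →
      ∀ᶠ m : ℕ in Filter.atTop, c * ((m : ℝ) ^ k * r ^ m) < 1 := by
    intro k c r hr0 hr1
    have h := (tendsto_pow_const_mul_const_pow_of_abs_lt_one k
      (by rwa [abs_of_nonneg hr0] : |r| < 1)).const_mul c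
    rw [mul_zero] at h
    exact h.eventually_lt_const one_pos
  filter_upwards [hcast.eventually_ge_atTop ((10000000 : ℝ) ^ n), Filter.eventually_ge_atTop 1,
    key 40 (4 ^ 20) (1 / 2) (by norm_num) (by norm_num),
    key (2 * B) (4 ^ B * C ^ 2) ((1 / 2) ^ (n + 2) / a ^ 2) (by positivity)
      ((div_lt_one (by positivity)).2 ha)] with m h1 h2 h3 h4
  have hm : (1 : ℝ) ≤ m := by exact_mod_cast h2
  refine ⟨by nlinarith, by nlinarith, ?_, ?_⟩
  · refine le_trans (le_of_eq ?_) h3.le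
    rw [mul_pow, ← pow_mul, mul_assoc]
  · refine lt_of_eq_of_lt ?_ h4
    rw [mul_pow, ← pow_mul, div_pow C, div_pow _ (a ^ 2), pow_right_comm _ m, pow_right_comm a m]
    ring

omit [InnerProductSpace ℝ E] [FiniteDimensional ℝ E] in
/-- A ball is contained in the truncated cone over the unit vectors close to its centre. -/
theorem exists_eq_smul_of_mem_ball [NormedSpace ℝ E] {e₀ y : E} (he₀ : ‖e₀‖ = 1)
    (hy : y ∈ Metric.ball ((3 / 2 : ℝ) • e₀) (1 / 8)) :
    ∃ ρ ∈ Set.Icc (1 : ℝ) 2, ∃ e : E, ‖e‖ = 1 ∧ ‖e - e₀‖ ≤ 1 / 4 ∧ y = ρ • e := by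
  rw [Metric.mem_ball, dist_eq_norm] at hy
  have h32 : ‖(3 / 2 : ℝ) • e₀‖ = 3 / 2 := by
    rw [norm_smul, he₀, Real.norm_eq_abs, abs_of_pos (by norm_num), mul_one]
  have habs := abs_norm_sub_norm_le y ((3 / 2 : ℝ) • e₀)
  rw [h32] at habs
  have hlt := abs_lt.1 (habs.trans_lt hy)
  have hpos : 0 < ‖y‖ := by linarith [hlt.1]
  have hunit : ‖‖y‖⁻¹ • y‖ = 1 := by
    rw [norm_smul, norm_inv, norm_norm, inv_mul_cancel₀ hpos.ne']
  have hy_eq : y = ‖y‖ • (‖y‖⁻¹ • y) := by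
    rw [smul_smul, mul_inv_cancel₀ hpos.ne', one_smul]
  refine ⟨‖y‖, ⟨by linarith [hlt.1], by linarith [hlt.2]⟩, ‖y‖⁻¹ • y, hunit, ?_, hy_eq⟩
  have h : (3 / 2 : ℝ) • (‖y‖⁻¹ • y - e₀) =
      (y - (3 / 2 : ℝ) • e₀) - (‖y‖ - 3 / 2) • (‖y‖⁻¹ • y) := by
    rw [sub_smul, ← hy_eq, smul_sub]; abel
  have h2 := norm_sub_le (y - (3 / 2 : ℝ) • e₀) ((‖y‖ - 3 / 2) • (‖y‖⁻¹ • y))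
  rw [← h, norm_smul, norm_smul, hunit, mul_one, Real.norm_eq_abs, Real.norm_eq_abs,
    abs_of_pos (by norm_num : (0 : ℝ) < 3 / 2)] at h2
  linarith

/-- The upper bound for the cone over the directions whose segments are well covered at a single
scale. -/
theorem measure_cone_le_of_cover [MeasurableSpace E] [BorelSpace E] (μ : Measure E)
    [μ.IsAddHaarMeasure] (hd : 2 ≤ finrank ℝ E) {a C : ℝ} {m : ℕ} (hm : 0 < m) (ha : 0 < a)
    (hΛ : (10000000 : ℝ) ^ finrank ℝ E ≤ 4 * (m : ℝ) ^ 2) (hmΛ : (m : ℝ) + 2 ≤ 4 * (m : ℝ) ^ 2)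
    (hΛδ : (4 * (m : ℝ) ^ 2) ^ 20 * (1 / 2) ^ m ≤ 1)
    (hsmall : (4 * (m : ℝ) ^ 2) ^ (8 * finrank ℝ E + 31) * ((1 / 2) ^ m) ^ (finrank ℝ E + 2) *
      (C / a ^ m) ^ 2 < 1) {F : Finset E} (hF : (F.card : ℝ) * a ^ m ≤ C) (x : E → E) {e₀ : E}
    {Ω : Set E} (hΩ : ∀ e ∈ Ω, ‖e‖ = 1) (hcap : ∀ e ∈ Ω, ‖e - e₀‖ ≤ 1 / 4)
    (hcov : ∀ e ∈ Ω, ENNReal.ofReal (1 / (m : ℝ) ^ 2) ≤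
      volume {t : ℝ | t ∈ Set.Icc (0 : ℝ) 1 ∧ ∃ p ∈ F, ‖x e + t • e - p‖ ≤ (1 / 2) ^ m}) :
    μ {y | ∃ ρ ∈ Set.Icc (1 : ℝ) 2, ∃ e ∈ Ω, y = ρ • e} ≤
      ENNReal.ofReal (3 ^ finrank ℝ E) * μ (Metric.ball 0 1) * ENNReal.ofReal (1 / (m : ℝ) ^ 2) := by
  have hm0 : (0 : ℝ) < m := by exact_mod_cast hm
  obtain ⟨I, hIΩ, hIsep, hIcov⟩ := exists_sep_subset_of_unit hΩ
    (by positivity : (0 : ℝ) < (1 / 2) ^ m)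
  have hI : 4 * (m : ℝ) ^ 2 * I.card * ((1 / 2) ^ m) ^ finrank ℝ E < (1 / 2) ^ m := by
    by_contra! hI
    have h1 := one_le_mul_card_sq_of_cover (F := F) (by positivity) hd hΛ hmΛ
      (le_of_eq (by rw [one_div, one_div, inv_pow, inv_inv])) hΛδ hIsep
      (fun v hv => hΩ v (hIΩ v hv)) (fun v hv w hw => ?_) x
      (by rw [mul_one_div, mul_div_assoc, div_self (by positivity), mul_one])
      (fun e he => hcov e (hIΩ e he)) hI
    · refine absurd (h1.trans ?_) (not_le.2 hsmall)
      gcongr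
      rwa [le_div_iff₀ (by positivity)]
    · rw [show v - w = (v - e₀) - (w - e₀) by abel]
      refine (norm_sub_le _ _).trans ?_
      linarith [hcap v (hIΩ v hv), hcap w (hIΩ w hw)]
  refine (measure_cone_le μ hIcov fun i hi => hΩ i (hIΩ i hi)).trans ?_
  rw [mul_right_comm, ← ENNReal.ofReal_mul (by positivity)]
  refine mul_le_mul_left (ENNReal.ofReal_le_ofReal ?_) _
  have h2 : (2 : ℝ) ^ m * (1 / 2) ^ m = 1 := by rw [← mul_pow]; norm_num
  have h3 : (1 : ℝ) ≤ 2 ^ m := one_le_pow₀ (by norm_num)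
  calc I.card * ((2 ^ m + 1) * (3 * (1 / 2 : ℝ) ^ m) ^ finrank ℝ E)
      = 3 ^ finrank ℝ E * (I.card * ((1 / 2 : ℝ) ^ m) ^ finrank ℝ E) * (2 ^ m + 1) := by
        rw [mul_pow]; ring
    _ ≤ 3 ^ finrank ℝ E * ((1 / 2 : ℝ) ^ m / (4 * (m : ℝ) ^ 2)) * (2 * 2 ^ m) := by
        gcongr
        · rw [le_div_iff₀ (by positivity)]
          linarith
        · linarith
    _ = 3 ^ finrank ℝ E * (1 / (m : ℝ) ^ 2) * (2 ^ m * (1 / 2) ^ m) / 2 := by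
        field_simp; norm_num
    _ ≤ 3 ^ finrank ℝ E * (1 / (m : ℝ) ^ 2) := by
        rw [h2, mul_one]
        exact half_le_self (by positivity)

/-- **Wolff's bound** for sets containing a unit segment in every direction. -/
theorem ofReal_le_dimH [MeasurableSpace E] [BorelSpace E] (hd : 2 ≤ finrank ℝ E) {K : Set E}
    (hK : ∀ e : E, ‖e‖ = 1 → ∃ x : E, segment ℝ x (x + e) ⊆ K) :
    ENNReal.ofReal (((finrank ℝ E : ℝ) + 2) / 2) ≤ dimH K := by
  by_contra! hlt
  set d := finrank ℝ E with hd'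
  obtain ⟨s, hKs, hsd⟩ := ENNReal.lt_iff_exists_nnreal_btwn.1 hlt
  have hs : 0 < (s : ℝ) := by
    have : (0 : ENNReal) < s := zero_le.trans_lt hKs
    exact_mod_cast this
  have hs2 : (s : ℝ) < ((d : ℝ) + 2) / 2 := by
    rwa [← ENNReal.ofReal_coe_nnreal, ENNReal.ofReal_lt_ofReal_iff (by positivity)] at hsd
  set a : ℝ := (1 / 2) ^ (s : ℝ) with ha
  have ha0 : 0 < a := by positivity
  have ha2 : (1 / 2 : ℝ) ^ (d + 2) < a ^ 2 := by
    rw [ha, ← Real.rpow_natCast, ← Real.rpow_natCast, ← Real.rpow_mul (by norm_num)]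
    refine Real.rpow_lt_rpow_of_exponent_gt (by norm_num) (by norm_num) ?_
    push_cast
    linarith
  have : Nontrivial E := nontrivial_of_finrank_pos (R := ℝ) (by omega)
  obtain ⟨e₀, he₀⟩ := exists_norm_eq E (zero_le_one : (0 : ℝ) ≤ 1)
  choose! x hx using hK
  let μ : Measure E := Measure.addHaar
  set w : ℕ → ENNReal := fun m => ENNReal.ofReal (1 / (m : ℝ) ^ 2) with hw
  set c : ENNReal := ENNReal.ofReal (3 ^ d) * μ (Metric.ball 0 1) with hc
  have hc_top : c ≠ ⊤ := ENNReal.mul_ne_top ENNReal.ofReal_ne_top measure_ball_lt_top.ne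
  have hw_sum : ∑' m, w m ≠ ⊤ :=
    (Real.summable_one_div_nat_pow.2 one_lt_two).tsum_ofReal_ne_top
  have htail := ENNReal.tendsto_sum_nat_add w hw_sum
  have htail' := ENNReal.Tendsto.const_mul htail (Or.inr hc_top)
  rw [mul_zero] at htail'
  have hball : 0 < μ (Metric.ball ((3 / 2 : ℝ) • e₀) (1 / 8)) :=
    Metric.measure_ball_pos _ _ (by norm_num)
  obtain ⟨k₁, hk₁⟩ := Filter.eventually_atTop.1 (eventually_scale_bounds (n := d)
    (B := 8 * d + 31) (C := 1 / a + 2) ha0 ha2)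
  obtain ⟨k₀, ⟨hk₀, hk₀1⟩, h1, h2⟩ := ((Filter.eventually_ge_atTop k₁).and
    (Filter.eventually_ge_atTop 1) |>.and ((htail.eventually_lt_const one_pos).and
    (htail'.eventually_lt_const hball))).exists
  obtain ⟨F, hFcard, hFcov⟩ := exists_dyadic_cover hs ha (hausdorffMeasure_of_dimH_lt hKs) k₀
  set T : ℕ → E → Set ℝ := fun m e =>
    {t | t ∈ Set.Icc (0 : ℝ) 1 ∧ ∃ p ∈ F m, ‖x e + t • e - p‖ ≤ (1 / 2) ^ m} with hT
  set Ω : ℕ → Set E := fun m => {e | ‖e‖ = 1 ∧ ‖e - e₀‖ ≤ 1 / 4 ∧ w m ≤ volume (T m e)} with hΩ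
  have hmem : ∀ e : E, ‖e‖ = 1 → ‖e - e₀‖ ≤ 1 / 4 → ∃ m, e ∈ Ω (m + k₀) := by
    intro e he hcap
    by_contra! h
    have h3 : ∀ m, volume (T (m + k₀) e) ≤ w (m + k₀) := fun m =>
      le_of_lt (not_le.1 fun h4 => h m ⟨he, hcap, h4⟩)
    have h4 : Set.Icc (0 : ℝ) 1 ⊆ ⋃ m, T (m + k₀) e := by
      intro t ht
      have hmemK : x e + t • e ∈ K := by
        refine hx e he ?_
        rw [segment_eq_image']
        exact ⟨t, ht, by simp⟩
      obtain ⟨m, hm, p, hp, hpx⟩ := hFcov _ hmemK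
      obtain ⟨j, rfl⟩ := Nat.exists_eq_add_of_le' hm
      exact Set.mem_iUnion.2 ⟨j, ht, p, hp, hpx⟩
    have h5 := calc (1 : ENNReal) = volume (Set.Icc (0 : ℝ) 1) := by simp
      _ ≤ _ := measure_mono h4
      _ ≤ ∑' m, volume (T (m + k₀) e) := measure_iUnion_le _
      _ ≤ ∑' m, w (m + k₀) := ENNReal.tsum_le_tsum h3
    exact absurd h5 (not_le.2 h1)
  set V : ℕ → Set E := fun m => {y | ∃ ρ ∈ Set.Icc (1 : ℝ) 2, ∃ e ∈ Ω m, y = ρ • e} with hV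
  have hVle : ∀ m, μ (V (m + k₀)) ≤ c * w (m + k₀) := by
    intro m
    obtain ⟨b1, b2, b3, b4⟩ := hk₁ (m + k₀) (by omega)
    exact measure_cone_le_of_cover μ hd (by omega) ha0 b1 b2 b3 b4 (hFcard _) x
      (fun e he => he.1) (fun e he => he.2.1) (fun e he => he.2.2)
  have hsub : Metric.ball ((3 / 2 : ℝ) • e₀) (1 / 8) ⊆ ⋃ m, V (m + k₀) := by
    intro y hy
    obtain ⟨ρ, hρ, e, he, hcap, rfl⟩ := exists_eq_smul_of_mem_ball he₀ hy
    obtain ⟨m, hm⟩ := hmem e he hcap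
    exact Set.mem_iUnion.2 ⟨m, ρ, hρ, e, hm, rfl⟩
  have h6 := calc μ (Metric.ball ((3 / 2 : ℝ) • e₀) (1 / 8)) ≤ _ := measure_mono hsub
    _ ≤ ∑' m, μ (V (m + k₀)) := measure_iUnion_le _
    _ ≤ ∑' m, c * w (m + k₀) := ENNReal.tsum_le_tsum hVle
    _ = c * ∑' m, w (m + k₀) := ENNReal.tsum_mul_left
  exact absurd h6 (not_le.2 h2)

end Reduction

end Kakeya

/-- Wolff: every Besicovitch set in `ℝⁿ` (`n ≥ 2`) has Hausdorff dimension at least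
`(n+2)/2`. -/
theorem wolff_hausdorff_bound (n : ℕ) (hn : 2 ≤ n)
    (K : Set (EuclideanSpace ℝ (Fin n))) (hK : IsCompact K)
    (hBes : ∀ e : EuclideanSpace ℝ (Fin n), ‖e‖ = 1 →
      ∃ x : EuclideanSpace ℝ (Fin n), segment ℝ x (x + e) ⊆ K) :
    ENNReal.ofReal (((n : ℝ) + 2) / 2) ≤ dimH K := by
  have h := Kakeya.ofReal_le_dimH (by rw [finrank_euclideanSpace_fin]; exact hn) hBes
  rwa [finrank_euclideanSpace_fin] at h
end

section
/- (Sums versus differences; Bourgain, after Balog–Szemerédi–Gowers) There exist absolute constants c > 0 and C ≥ 1 such that for every abelian group G, every real N ≥ 1, and all finite subsets A, B ⊆ G with #A ≤ N, #B ≤ N, and #(A+B) ≤ N, one has #(A−B) ≤ C·N^{2−c}. -/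
open Pointwise
open Finset in
/-- The difference set is controlled by the sumset: `#(A-B)² ≤ #(A+B)³`. -/
theorem card_sub_sq_le_card_add_cube {G : Type*} [AddCommGroup G] [DecidableEq G]
    (A B : Finset G) : (A - B).card ^ 2 ≤ (A + B).card ^ 3 := by
  have h₁ : (A - B).card * A.card ≤ (A + A).card * (A + B).card := by
    simpa only [add_comm B A] using ruzsa_triangle_inequality_sub_add_add A A B
  have h₂ : (A + A).card * B.card ≤ (A + B).card * (A + B).card := by
    simpa only [add_comm B A] using ruzsa_triangle_inequality_add_add_add A B A
  calc (A - B).card ^ 2 = (A - B).card * (A - B).card := sq _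
    _ ≤ (A - B).card * (A.card * B.card) := by gcongr; exact card_sub_le
    _ = (A - B).card * A.card * B.card := by ring
    _ ≤ (A + A).card * (A + B).card * B.card := by gcongr
    _ = (A + A).card * B.card * (A + B).card := by ring
    _ ≤ (A + B).card * (A + B).card * (A + B).card := by gcongr
    _ = (A + B).card ^ 3 := by ring

/-- Sums versus differences (Bourgain, after Balog–Szemerédi–Gowers): there are
absolute constants `c > 0` and `C ≥ 1` such that for every abelian group `G`, every
real `N ≥ 1` and all finite `A, B ⊆ G` with `#A ≤ N`, `#B ≤ N`, `#(A+B) ≤ N`, one has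
`#(A-B) ≤ C·N^{2-c}`. -/
theorem sums_versus_differences :
    ∃ c : ℝ, 0 < c ∧ ∃ C : ℝ, 1 ≤ C ∧
      ∀ (G : Type*) [AddCommGroup G] [DecidableEq G] (N : ℝ), 1 ≤ N →
        ∀ A B : Finset G,
          ((A.card : ℝ) ≤ N) → ((B.card : ℝ) ≤ N) → (((A + B).card : ℝ) ≤ N) →
          ((A - B).card : ℝ) ≤ C * N ^ (2 - c) := by
  refine ⟨1 / 2, by norm_num, 1, le_rfl, fun G _ _ N hN A B _ _ hAB ↦ ?_⟩
  rw [one_mul]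
  have hN0 : 0 ≤ N := by linarith
  refine le_of_pow_le_pow_left₀ two_ne_zero (by positivity) ?_
  calc ((A - B).card : ℝ) ^ 2 ≤ ((A + B).card : ℝ) ^ 3 := by
        exact_mod_cast card_sub_sq_le_card_add_cube A B
    _ ≤ N ^ 3 := by gcongr
    _ = (N ^ (2 - 1 / 2 : ℝ)) ^ 2 := by
        rw [← Real.rpow_mul_natCast hN0, ← Real.rpow_natCast]
        norm_num
end

section
/- (Lines in the SL₂ example) Let p be a prime, let R = 𝔽_p[t]/(t²), and write t for the image of the variable in R, so that every element of R can be written uniquely as r₁ + r₂·t with r₁, r₂ ∈ 𝔽_p. Let X = {(x₁ + x₂t, y₁ + y₂t, z₁ + z₂t) ∈ R³ : z₂ = x₁y₂ − x₂y₁}. Then for all a, b, c, d, e ∈ 𝔽_p with ad − bc = 1, the line L = {(a + eat, b + ebt, 0) + s·(c + ect, d + edt, 1) : s ∈ R} is contained in X. -/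
open Polynomial

/-- The ring `R = 𝔽_p[t]/(t²)`. -/
noncomputable abbrev Rp (p : ℕ) : Type :=
  AdjoinRoot (X ^ 2 : (ZMod p)[X])

/-- The image of the variable `t` in `R = 𝔽_p[t]/(t²)`. -/
noncomputable def tp (p : ℕ) : Rp p :=
  AdjoinRoot.root _

/-- The inclusion `𝔽_p → R`. -/
noncomputable def ip (p : ℕ) : ZMod p →+* Rp p :=
  algebraMap _ _

/-- The SL₂ example: `X = {(x₁+x₂t, y₁+y₂t, z₁+z₂t) ∈ R³ : z₂ = x₁y₂ − x₂y₁}`. -/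
def SL2set (p : ℕ) : Set (Rp p × Rp p × Rp p) :=
  {q | ∃ x₁ x₂ y₁ y₂ z₁ z₂ : ZMod p,
    q.1 = ip p x₁ + ip p x₂ * tp p ∧
    q.2.1 = ip p y₁ + ip p y₂ * tp p ∧
    q.2.2 = ip p z₁ + ip p z₂ * tp p ∧
    z₂ = x₁ * y₂ - x₂ * y₁}

theorem tp_sq (p : ℕ) : tp p ^ 2 = 0 := by
  have h := AdjoinRoot.mk_self (f := (X ^ 2 : (ZMod p)[X]))
  rwa [map_pow, AdjoinRoot.mk_X] at h

theorem exists_eq_ip_add_ip_mul_tp (p : ℕ) (s : Rp p) :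
    ∃ s₁ s₂ : ZMod p, s = ip p s₁ + ip p s₂ * tp p := by
  obtain ⟨f, rfl⟩ := AdjoinRoot.mk_surjective s
  refine ⟨f.coeff 0, f.divX.coeff 0, ?_⟩
  have hC (r : ZMod p) : AdjoinRoot.mk (X ^ 2 : (ZMod p)[X]) (C r) = ip p r := rfl
  have hX : AdjoinRoot.mk (X ^ 2 : (ZMod p)[X]) X = tp p := rfl
  have hf := congrArg (AdjoinRoot.mk (X ^ 2 : (ZMod p)[X])) (divX_mul_X_add f)
  have hg := congrArg (AdjoinRoot.mk (X ^ 2 : (ZMod p)[X])) (divX_mul_X_add f.divX)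
  rw [map_add, map_mul, hC, hX] at hf hg
  rw [← hf, ← hg]
  linear_combination AdjoinRoot.mk (X ^ 2 : (ZMod p)[X]) f.divX.divX * tp_sq p

/-- For `a, b, c, d, e ∈ 𝔽_p` with `ad − bc = 1`, the line
`L = {(a + eat, b + ebt, 0) + s·(c + ect, d + edt, 1) : s ∈ R}` is contained in `X`. -/
theorem sl2_contains_lines (p : ℕ) (hp : p.Prime) (a b c d e : ZMod p)
    (h : a * d - b * c = 1) :
    {q : Rp p × Rp p × Rp p | ∃ s : Rp p,
        q = (ip p a + ip p e * ip p a * tp p + s * (ip p c + ip p e * ip p c * tp p),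
             ip p b + ip p e * ip p b * tp p + s * (ip p d + ip p e * ip p d * tp p),
             0 + s * 1)} ⊆ SL2set p := by
  rintro _ ⟨s, rfl⟩
  obtain ⟨s₁, s₂, rfl⟩ := exists_eq_ip_add_ip_mul_tp p s
  have ht := tp_sq p
  refine ⟨a + s₁ * c, e * (a + s₁ * c) + s₂ * c, b + s₁ * d, e * (b + s₁ * d) + s₂ * d,
    s₁, s₂, ?_, ?_, ?_, ?_⟩
  · simp only [map_add, map_mul]
    linear_combination ip p s₂ * ip p e * ip p c * ht
  · simp only [map_add, map_mul]
    linear_combination ip p s₂ * ip p e * ip p d * ht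
  · ring
  · linear_combination -s₂ * h
end
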